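/- Let V be an optimal computer and let T ∈ (0,1). If the energy E_V(T) = Z_V(T)^{−1} Σ_{p ∈ Dom V} |p| 2^{−|p|/T} is a computable real, then T is Chaitin T-random and T-compressible. -/

import Mathlib

open Filter Topology

/-- A set of finite binary strings is prefix-free if no string in it is a
proper prefix of another string in it. -/
def PrefixFree (S : Set (List Bool)) : Prop :=
  ∀ p ∈ S, ∀ q ∈ S, p <+: q → p = q

/-- A computer: a partial recursive function from finite binary strings to
finite binary strings whose domain is a nonempty prefix-free set. -/
structure Computer where
  f : List Bool →. List Bool
  partrec : Partrec f
  dom_nonempty : f.Dom.Nonempty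
  dom_prefixFree : PrefixFree f.Dom

/-- A computer `U` is optimal if for each computer `C` there is `d ∈ ℕ` such
that every `p ∈ Dom C` admits `q` with `U(q) = C(p)` and `|q| ≤ |p| + d`. -/
def Optimal (U : Computer) : Prop :=
  ∀ C : Computer, ∃ d : ℕ, ∀ p ∈ C.f.Dom,
    ∃ q : List Bool, U.f q = C.f p ∧ q.length ≤ p.length + d

/-- `H_C(s)`: the length of a shortest program for `C` printing `s`. -/
noncomputable def complexity (C : Computer) (s : List Bool) : ℕ :=
  sInf {n | ∃ p : List Bool, s ∈ C.f p ∧ p.length = n}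

/-- The `i`-th bit (for `i = 0, 1, 2, …`) of the base-two expansion of
`α - ⌊α⌋` with infinitely many zeros. -/
noncomputable def bitOf (α : ℝ) (i : ℕ) : Bool :=
  decide (⌊(α - ⌊α⌋) * 2 ^ (i + 1)⌋ % 2 = 1)

/-- `α↾n`: the first `n` bits of the base-two expansion of `α - ⌊α⌋`
with infinitely many zeros. -/
noncomputable def firstBits (α : ℝ) (n : ℕ) : List Bool :=
  (List.range n).map (bitOf α)

/-- A real `α` is computable if some total recursive `f : ℕ⁺ → ℚ` satisfies
`|α - f n| < 1/n` for all `n ≥ 1`. -/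
def ComputableReal (α : ℝ) : Prop :=
  ∃ f : ℕ → ℚ, Computable f ∧ ∀ n : ℕ, 0 < n → |α - (f n : ℝ)| < 1 / n

/-- `α` is weakly Chaitin `T`-random (w.r.t. the computer `U`). -/
def WeaklyChaitinTRandom (U : Computer) (T α : ℝ) : Prop :=
  ∃ c : ℕ, ∀ n : ℕ, 0 < n → T * n - c ≤ (complexity U (firstBits α n) : ℝ)

/-- `α` is Chaitin `T`-random (w.r.t. the computer `U`). -/
def ChaitinTRandom (U : Computer) (T α : ℝ) : Prop :=
  Tendsto (fun n : ℕ => (complexity U (firstBits α n) : ℝ) - T * n) atTop atTop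

/-- `α` is `T`-compressible (w.r.t. the computer `U`): `H(α↾n) ≤ Tn + o(n)`. -/
def TCompressible (U : Computer) (T α : ℝ) : Prop :=
  ∃ g : ℕ → ℝ, Tendsto (fun n : ℕ => g n / n) atTop (nhds 0) ∧
    ∀ n : ℕ, 0 < n → (complexity U (firstBits α n) : ℝ) ≤ T * n + g n

/-- The Boltzmann factor `2^(-|p|/T)` of a program `p`. -/
noncomputable def boltzmann (T : ℝ) (p : List Bool) : ℝ :=
  (2 : ℝ) ^ (-(p.length : ℝ) / T)

/-- Partition function `Z_C(T) = Σ_{p ∈ Dom C} 2^(-|p|/T)`. -/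
noncomputable def Zfun (C : Computer) (T : ℝ) : ℝ :=
  ∑' p : C.f.Dom, boltzmann T p.1

/-- Free energy `F_C(T) = -T log₂ Z_C(T)`. -/
noncomputable def Ffun (C : Computer) (T : ℝ) : ℝ :=
  -T * Real.logb 2 (Zfun C T)

/-- Energy `E_C(T) = Z_C(T)⁻¹ Σ_{p ∈ Dom C} |p| 2^(-|p|/T)`. -/
noncomputable def Efun (C : Computer) (T : ℝ) : ℝ :=
  (Zfun C T)⁻¹ * ∑' p : C.f.Dom, (p.1.length : ℝ) * boltzmann T p.1

/-- Statistical mechanical entropy `S_C(T) = (E_C(T) - F_C(T))/T`. -/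
noncomputable def Sfun (C : Computer) (T : ℝ) : ℝ :=
  (Efun C T - Ffun C T) / T

/-- `𝒵(V)`: the set of `T ∈ (0,1)` with `Z_V(T)` computable. -/
def setZ (V : Computer) : Set ℝ := {T | T ∈ Set.Ioo 0 1 ∧ ComputableReal (Zfun V T)}

/-- `ℱ(V)`: the set of `T ∈ (0,1)` with `F_V(T)` computable. -/
def setF (V : Computer) : Set ℝ := {T | T ∈ Set.Ioo 0 1 ∧ ComputableReal (Ffun V T)}

/-- `ℰ(V)`: the set of `T ∈ (0,1)` with `E_V(T)` computable. -/
def setE (V : Computer) : Set ℝ := {T | T ∈ Set.Ioo 0 1 ∧ ComputableReal (Efun V T)}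

/-- `𝒮(V)`: the set of `T ∈ (0,1)` with `S_V(T)` computable. -/
def setS (V : Computer) : Set ℝ := {T | T ∈ Set.Ioo 0 1 ∧ ComputableReal (Sfun V T)}

/-- `FP_w` (w.r.t. the optimal computer `U` fixing `H`): the set of `T ∈ (0,1)`
that are weakly Chaitin `T`-random and `T`-compressible. -/
def FPw (U : Computer) : Set ℝ :=
  {T | T ∈ Set.Ioo 0 1 ∧ WeaklyChaitinTRandom U T T ∧ TCompressible U T T}

/-- `FP` (w.r.t. the optimal computer `U` fixing `H`): the set of `T ∈ (0,1)`
that are Chaitin `T`-random and `T`-compressible. -/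
def FP (U : Computer) : Set ℝ :=
  {T | T ∈ Set.Ioo 0 1 ∧ ChaitinTRandom U T T ∧ TCompressible U T T}

/-- A computer is physically reasonable if its domain contains two strings of
different lengths. -/
def PhysicallyReasonable (C : Computer) : Prop :=
  ∃ p ∈ C.f.Dom, ∃ q ∈ C.f.Dom, p.length ≠ q.length

/-- A computable measure machine: `Z_C(1)` is a computable real. -/
def ComputableMeasureMachine (C : Computer) : Prop :=
  ComputableReal (Zfun C 1)

/-- `D` is the composition `C₀ ⊘ C₁ ⊘ ⋯ ⊘ C_{N-1}`: its domain consists of the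
concatenations `p₀p₁⋯p_{N-1}` with each `pᵢ ∈ Dom Cᵢ`, and on such a
concatenation it returns `C₀(p₀)`. -/
def IsComposition {N : ℕ} (C : Fin N → Computer) (hN : 0 < N) (D : Computer) : Prop :=
  (∀ l, l ∈ D.f.Dom ↔
      ∃ ps : Fin N → List Bool, (∀ i, ps i ∈ (C i).f.Dom) ∧ l = (List.ofFn ps).flatten) ∧
  (∀ ps : Fin N → List Bool, (∀ i, ps i ∈ (C i).f.Dom) →
      D.f ((List.ofFn ps).flatten) = (C ⟨0, hN⟩).f (ps ⟨0, hN⟩))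

/-- A sequence of computers is recursive if a single partial recursive function
uniformly computes all of them. -/
def RecursiveSeq (V : ℕ → Computer) : Prop :=
  ∃ F : ℕ × List Bool →. List Bool, Partrec F ∧ ∀ n p, (V n).f p = F (n, p)
/-- Unbounded search for the least number satisfying a Boolean predicate. -/
def search (q : ℕ → Bool) : Part ℕ := Nat.rfind (PFun.lift q)

theorem mem_search {q : ℕ → Bool} {n : ℕ} :
    n ∈ search q ↔ q n = true ∧ ∀ m < n, q m = false := by
  unfold search
  rw [Nat.mem_rfind]
  simp only [PFun.coe_val, Part.mem_some_iff, eq_comm (a := true), eq_comm (a := false)]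

theorem search_dom {q : ℕ → Bool} {n : ℕ} (h : q n = true) : ∃ m, m ∈ search q := by
  classical
  have hex : ∃ n, q n = true := ⟨n, h⟩
  refine ⟨Nat.find hex, mem_search.2 ⟨Nat.find_spec hex, fun m hm => ?_⟩⟩
  simpa using Nat.find_min hex hm

theorem partrec_search {α : Type*} [Primcodable α] {q : α → ℕ → Bool} (hq : Computable₂ q) :
    Partrec fun a => search (q a) :=
  Partrec.rfind hq.partrec₂

/-- The code of a rational used by its `Primcodable` instance. -/
def ratEnc (r : ℚ) : ℕ := @Encodable.encode ℚ Primcodable.toEncodable r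

theorem ratEnc_injective : Function.Injective ratEnc := @Encodable.encode_injective ℚ Primcodable.toEncodable

/-- The code of a rational for the sigma encoding. -/
def ratCode (r : ℚ) : ℕ := @Encodable.encode ℚ Rat.instEncodable r

def inRatRange (m : ℕ) : Prop :=
  0 < m.unpair.2 ∧ ∀ x < m.unpair.2 + 1, (m.unpair.2 % x = 0 ∧ ((m.unpair.1 + 1) / 2) % x = 0) → x = 1

instance : DecidablePred inRatRange := fun m => by unfold inRatRange; infer_instance

theorem ratCode_eq (r : ℚ) : ratCode r = Nat.pair (Encodable.encode r.num) r.den := rfl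

theorem int_encode_ofNat (n : ℕ) : Encodable.encode (Int.ofNat n) = 2 * n := rfl
theorem int_encode_negSucc (n : ℕ) : Encodable.encode (Int.negSucc n) = 2 * n + 1 := rfl

theorem int_encode_natAbs (z : ℤ) : (Encodable.encode z + 1) / 2 = z.natAbs := by
  cases z with
  | ofNat n => rw [int_encode_ofNat]; simp; omega
  | negSucc n => rw [int_encode_negSucc]; simp; omega

theorem coprime_iff_aux (a d : ℕ) (hd : 0 < d) :
    (∀ x < d + 1, (d % x = 0 ∧ a % x = 0) → x = 1) ↔ a.Coprime d := by
  constructor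
  · intro h
    exact h (a.gcd d) (Nat.lt_succ_of_le (Nat.gcd_le_right _ hd))
      ⟨Nat.mod_eq_zero_of_dvd (Nat.gcd_dvd_right _ _), Nat.mod_eq_zero_of_dvd (Nat.gcd_dvd_left _ _)⟩
  · rintro h x - ⟨h1, h2⟩
    exact Nat.dvd_one.mp (h ▸ Nat.dvd_gcd (Nat.dvd_of_mod_eq_zero h2) (Nat.dvd_of_mod_eq_zero h1))

theorem inRatRange_iff (m : ℕ) : inRatRange m ↔ ∃ r : ℚ, ratCode r = m := by
  constructor
  · rintro ⟨h1, h2⟩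
    rw [coprime_iff_aux _ _ h1] at h2
    have hz : ∃ z : ℤ, Encodable.encode z = m.unpair.1 :=
      ⟨Denumerable.ofNat ℤ m.unpair.1, Denumerable.encode_ofNat _⟩
    obtain ⟨z, hz⟩ := hz
    rw [← hz, int_encode_natAbs] at h2
    refine ⟨⟨z, m.unpair.2, h1.ne', h2⟩, ?_⟩
    rw [ratCode_eq]
    simp [hz]
  · rintro ⟨r, rfl⟩
    rw [ratCode_eq]
    refine ⟨by simpa using r.den_pos, ?_⟩
    rw [coprime_iff_aux _ _ (by simpa using r.den_pos)]
    simp only [Nat.unpair_pair, int_encode_natAbs]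
    exact r.reduced

theorem rat_encode_eq (r : ℚ) :
    ratEnc r = ((List.range (ratCode r)).filter (fun m => decide (inRatRange m))).length := by
  classical
  rw [← List.countP_eq_length_filter]
  have : ∀ l : List ℕ, List.countP (fun m => decide (inRatRange m)) l =
     List.countP (fun m => @decide (m ∈ Set.range (@Encodable.encode ℚ Rat.instEncodable)) (@Encodable.decidableRangeEncode ℚ Rat.instEncodable m)) l := by
    intro l
    congr 1
    funext m
    rw [decide_eq_decide, inRatRange_iff]
    rfl
  rw [this]
  rfl

theorem primrec_inRatRange : PrimrecPred inRatRange := by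
  have hu : Primrec Nat.unpair := Primrec.unpair
  have h1 : PrimrecPred fun m : ℕ => 0 < m.unpair.2 :=
    Primrec.nat_lt.comp (Primrec.const 0) (Primrec.snd.comp hu)
  have hR : PrimrecRel fun (x : ℕ) (m : ℕ) =>
      (m.unpair.2 % x = 0 ∧ ((m.unpair.1 + 1) / 2) % x = 0) → x = 1 := by
    have e1 : PrimrecPred fun p : ℕ × ℕ => p.2.unpair.2 % p.1 = 0 :=
      Primrec.eq.comp (Primrec.nat_mod.comp (Primrec.snd.comp (hu.comp Primrec.snd)) Primrec.fst)
        (Primrec.const 0)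
    have e2 : PrimrecPred fun p : ℕ × ℕ => ((p.2.unpair.1 + 1) / 2) % p.1 = 0 :=
      Primrec.eq.comp (Primrec.nat_mod.comp (Primrec.nat_div.comp
        (Primrec.nat_add.comp (Primrec.fst.comp (hu.comp Primrec.snd)) (Primrec.const 1))
        (Primrec.const 2)) Primrec.fst)
        (Primrec.const 0)
    have e3 : PrimrecPred fun p : ℕ × ℕ => p.1 = 1 :=
      Primrec.eq.comp Primrec.fst (Primrec.const 1)
    refine PrimrecPred.of_eq ((e1.and e2).not.or e3) ?_
    intro p
    exact imp_iff_not_or.symm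
  have h2 := (PrimrecRel.forall_lt hR).comp (Primrec.succ.comp (Primrec.snd.comp hu)) Primrec.id
  exact h1.and h2

theorem computable_ratCode : Computable ratCode := by
  have hcount : Primrec fun m : ℕ =>
      ((List.range m).filter (fun m => decide (inRatRange m))).length :=
    Primrec.list_length.comp ((Primrec.listFilter primrec_inRatRange).comp Primrec.list_range)
  have hq : Primrec₂ fun (r : ℚ) (m : ℕ) => decide (inRatRange m ∧
      ((List.range m).filter (fun m => decide (inRatRange m))).length = ratEnc r) := by
    refine PrimrecPred.decide (p := fun p : ℚ × ℕ => inRatRange p.2 ∧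
      ((List.range p.2).filter (fun m => decide (inRatRange m))).length = ratEnc p.1) ?_
    exact (primrec_inRatRange.comp Primrec.snd).and
      (Primrec.eq.comp (hcount.comp Primrec.snd) (Primrec.encode.comp Primrec.fst))
  refine Partrec.of_eq_tot (partrec_search hq.to_comp) ?_
  intro r
  rw [mem_search]
  constructor
  · rw [decide_eq_true_eq]
    exact ⟨(inRatRange_iff _).2 ⟨r, rfl⟩, (rat_encode_eq r).symm⟩
  · intro m hm
    rw [decide_eq_false_iff_not]
    rintro ⟨h1, h2⟩
    obtain ⟨r', rfl⟩ := (inRatRange_iff _).1 h1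
    rw [← rat_encode_eq] at h2
    have := ratEnc_injective h2
    subst this
    exact lt_irrefl _ hm

/-- Natural number approximations `g s ≈ E 2^s` of a nonnegative computable real. -/
theorem exists_nat_approx (E : ℝ) (hE0 : 0 ≤ E)
    (hE : ∃ f : ℕ → ℚ, Computable f ∧ ∀ n : ℕ, 0 < n → |E - (f n : ℝ)| < 1 / n) :
    ∃ g : ℕ → ℕ, Computable g ∧ ∀ s, |E * 2 ^ s - g s| ≤ 2 := by
  obtain ⟨f, hf, hfE⟩ := hE
  have hpow : Primrec₂ ((· ^ ·) : ℕ → ℕ → ℕ) := Primrec₂.unpaired'.1 Nat.Primrec.pow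
  let h : ℕ × ℕ → ℕ := fun p =>
    (if p.1.unpair.1 % 2 = 0 then p.1.unpair.1 / 2 else 0) * 2 ^ p.2 / p.1.unpair.2
  have hu : Primrec fun p : ℕ × ℕ => p.1.unpair := Primrec.unpair.comp Primrec.fst
  have hh : Primrec h := by
    refine Primrec.nat_div.comp (Primrec.nat_mul.comp (Primrec.ite ?_ ?_ ?_) ?_) ?_
    · exact Primrec.eq.comp (Primrec.nat_mod.comp (Primrec.fst.comp hu) (Primrec.const 2))
        (Primrec.const 0)
    · exact Primrec.nat_div.comp (Primrec.fst.comp hu) (Primrec.const 2)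
    · exact Primrec.const 0
    · exact hpow.comp (Primrec.const 2) Primrec.snd
    · exact Primrec.snd.comp hu
  have hp2 : Computable fun s : ℕ => 2 ^ s := (hpow.comp (Primrec.const 2) Primrec.id).to_comp
  refine ⟨fun s => h (ratCode (f (2 ^ s)), s),
    hh.to_comp.comp ((computable_ratCode.comp (hf.comp hp2)).pair Computable.id), ?_⟩
  intro s
  set r := f (2 ^ s) with hr
  have hval : h (ratCode r, s) = r.num.toNat * 2 ^ s / r.den := by
    simp only [h, ratCode_eq, Nat.unpair_pair]
    congr 2
    rcases hz : r.num with n | n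
    · rw [int_encode_ofNat]; simp
    · rw [int_encode_negSucc]; simp
  show |E * 2 ^ s - (h (ratCode r, s) : ℝ)| ≤ 2
  rw [hval]
  have h1 := hfE (2 ^ s) (by positivity)
  rw [← hr] at h1
  have hpos : (0:ℝ) < 2 ^ s := by positivity
  have h2 : |E * 2 ^ s - r * 2 ^ s| < 1 := by
    rw [← sub_mul, abs_mul, abs_of_pos hpos]
    push_cast at h1
    rwa [lt_div_iff₀ hpos] at h1
  have hd : (0:ℝ) < r.den := by exact_mod_cast r.den_pos
  have hmax : ((r.num.toNat : ℕ) : ℝ) / r.den = max (r : ℝ) 0 := by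
    have e1 : ((r.num.toNat : ℕ) : ℝ) = max (r.num : ℝ) 0 := by
      have : ((r.num.toNat : ℕ) : ℤ) = max r.num 0 := Int.toNat_eq_max r.num
      exact_mod_cast congrArg (Int.cast : ℤ → ℝ) this
    rw [e1, Rat.cast_def, ← max_div_div_right hd.le, zero_div]
  have h3 : |E * 2 ^ s - max (r:ℝ) 0 * 2 ^ s| < 1 := by
    rcases le_total (r:ℝ) 0 with h0 | h0
    · rw [max_eq_right h0, abs_lt]
      rw [abs_lt] at h2
      have : (r:ℝ) * 2 ^ s ≤ 0 := mul_nonpos_of_nonpos_of_nonneg h0 hpos.le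
      have : 0 ≤ E * 2 ^ s := by positivity
      constructor <;> linarith
    · rwa [max_eq_left h0]
  have h4 : |max (r:ℝ) 0 * 2 ^ s - ((r.num.toNat * 2 ^ s / r.den : ℕ) : ℝ)| ≤ 1 := by
    have e : max (r:ℝ) 0 * 2 ^ s = ((r.num.toNat * 2 ^ s : ℕ) : ℝ) / r.den := by
      rw [← hmax]; push_cast; ring
    rw [e, ← Nat.floor_div_eq_div (K := ℝ)]
    have a1 := Nat.floor_le (a := ((r.num.toNat * 2 ^ s : ℕ) : ℝ) / r.den) (by positivity)
    have a2 := Nat.lt_floor_add_one (((r.num.toNat * 2 ^ s : ℕ) : ℝ) / r.den)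
    rw [abs_le]; constructor <;> linarith
  calc _ ≤ _ := abs_sub_le _ (max (r:ℝ) 0 * 2 ^ s) _
    _ ≤ 2 := by linarith

theorem primrec_pow : Primrec₂ ((· ^ ·) : ℕ → ℕ → ℕ) := Primrec₂.unpaired'.1 Nat.Primrec.pow

theorem primrec_sum_map {α β : Type*} [Primcodable α] [Primcodable β] {f : α → List β}
    {g : α → β → ℕ} (hf : Primrec f) (hg : Primrec₂ g) :
    Primrec fun a => ((f a).map (g a)).sum := by
  have := Primrec.list_foldr (f := fun a => (f a).map (g a)) (g := fun _ : α => 0)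
    (h := fun _ p => p.1 + p.2) (Primrec.list_map hf hg) (Primrec.const 0)
    (Primrec.nat_add.comp (Primrec.fst.comp Primrec.snd) (Primrec.snd.comp Primrec.snd)).to₂
  refine this.of_eq fun a => ?_
  rw [List.sum_eq_foldr]

/-- `⌊2^s 2^(-L/t)⌋` for `t = a / 2^n`. -/
def root (q : ℕ × ℕ × ℕ) (L : ℕ) : ℕ :=
  Nat.findGreatest (fun x => x ^ q.1 * 2 ^ (L * 2 ^ q.2.1) ≤ 2 ^ (q.2.2 * q.1)) (2 ^ q.2.2)

theorem primrec_root : Primrec₂ root := by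
  have h1 : Primrec fun p : (ℕ × ℕ × ℕ) × ℕ => p.1.1 := Primrec.fst.comp Primrec.fst
  have h2 : Primrec fun p : (ℕ × ℕ × ℕ) × ℕ => p.1.2.1 :=
    Primrec.fst.comp (Primrec.snd.comp Primrec.fst)
  have h3 : Primrec fun p : (ℕ × ℕ × ℕ) × ℕ => p.1.2.2 :=
    Primrec.snd.comp (Primrec.snd.comp Primrec.fst)
  have two : ∀ {α : Type} [Primcodable α], Primrec fun _ : α => 2 := Primrec.const 2
  refine Primrec.nat_findGreatest (f := fun p : (ℕ × ℕ × ℕ) × ℕ => 2 ^ p.1.2.2)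
    (p := fun p x => x ^ p.1.1 * 2 ^ (p.2 * 2 ^ p.1.2.1) ≤ 2 ^ (p.1.2.2 * p.1.1))
    (primrec_pow.comp two h3) ?_
  refine Primrec.nat_le.comp₂ ?_ ?_
  · exact (Primrec.nat_mul.comp (primrec_pow.comp Primrec.snd (h1.comp Primrec.fst))
      (primrec_pow.comp two (Primrec.nat_mul.comp (Primrec.snd.comp Primrec.fst)
        (primrec_pow.comp two (h2.comp Primrec.fst))))).to₂
  · exact (primrec_pow.comp two (Primrec.nat_mul.comp (h3.comp Primrec.fst)
      (h1.comp Primrec.fst))).to₂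

/-- Positivity certificate; the input is `((a, n, s), g, ℓ)`. -/
def certP (c : ℕ) (q : (ℕ × ℕ × ℕ) × ℕ × List ℕ) : Bool :=
  decide (q.2.1 * (q.2.2.map (root q.1)).sum + 2 ^ q.1.2.2 * (q.2.2.map (fun L => L + c)).sum <
    2 ^ q.1.2.2 * (q.2.2.map (fun L => L * root q.1 L)).sum)

def certN (c : ℕ) (q : (ℕ × ℕ × ℕ) × ℕ × List ℕ) : Bool :=
  decide (2 ^ q.1.2.2 * (q.2.2.map (fun L => L * root q.1 L)).sum +
      2 ^ q.1.2.2 * (q.2.2.map (fun L => L + c)).sum < q.2.1 * (q.2.2.map (root q.1)).sum)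

section
variable (c : ℕ)

theorem primrec_aux :
    Primrec (fun q : (ℕ × ℕ × ℕ) × ℕ × List ℕ => q.2.1 * (q.2.2.map (root q.1)).sum) ∧
    Primrec (fun q : (ℕ × ℕ × ℕ) × ℕ × List ℕ =>
      2 ^ q.1.2.2 * (q.2.2.map (fun L => L + c)).sum) ∧
    Primrec (fun q : (ℕ × ℕ × ℕ) × ℕ × List ℕ =>
      2 ^ q.1.2.2 * (q.2.2.map (fun L => L * root q.1 L)).sum) := by
  have hs : Primrec (fun q : (ℕ × ℕ × ℕ) × ℕ × List ℕ => 2 ^ q.1.2.2) :=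
    primrec_pow.comp (Primrec.const 2) (Primrec.snd.comp (Primrec.snd.comp Primrec.fst))
  have hg : Primrec (fun q : (ℕ × ℕ × ℕ) × ℕ × List ℕ => q.2.1) :=
    Primrec.fst.comp Primrec.snd
  have hl : Primrec (fun q : (ℕ × ℕ × ℕ) × ℕ × List ℕ => q.2.2) :=
    Primrec.snd.comp Primrec.snd
  have hr : Primrec₂ (fun (q : (ℕ × ℕ × ℕ) × ℕ × List ℕ) (L : ℕ) => root q.1 L) :=
    (primrec_root.comp (Primrec.fst.comp Primrec.fst) Primrec.snd).to₂
  refine ⟨Primrec.nat_mul.comp hg (primrec_sum_map hl hr),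
    Primrec.nat_mul.comp hs (primrec_sum_map hl ?_),
    Primrec.nat_mul.comp hs (primrec_sum_map hl ?_)⟩
  · exact (Primrec.nat_add.comp Primrec.snd (Primrec.const c)).to₂
  · exact (Primrec.nat_mul.comp Primrec.snd hr).to₂

theorem primrec_certP : Primrec (certP c) := by
  obtain ⟨h0, hb, h1⟩ := primrec_aux c
  exact (Primrec.nat_lt.comp (Primrec.nat_add.comp h0 hb) h1).decide

theorem primrec_certN : Primrec (certN c) := by
  obtain ⟨h0, hb, h1⟩ := primrec_aux c
  exact (Primrec.nat_lt.comp (Primrec.nat_add.comp h1 hb) h0).decide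
end

theorem root_spec (a n s L : ℕ) (ha : 0 < a) :
    (root (a, n, s) L : ℝ) ≤ 2 ^ s * (2:ℝ) ^ (-(L:ℝ) / ((a:ℝ) / 2 ^ n)) ∧
    2 ^ s * (2:ℝ) ^ (-(L:ℝ) / ((a:ℝ) / 2 ^ n)) < root (a, n, s) L + 1 := by
  set w := (2:ℝ) ^ (-(L:ℝ) / ((a:ℝ) / 2 ^ n)) with hw
  have ha' : (0:ℝ) < a := by exact_mod_cast ha
  have hw0 : 0 < w := by positivity
  have hw1 : w ≤ 1 := by
    apply Real.rpow_le_one_of_one_le_of_nonpos (by norm_num)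
    rw [neg_div]; exact neg_nonpos.2 (by positivity)
  have hwa : w ^ a * 2 ^ (L * 2 ^ n) = 1 := by
    rw [← Real.rpow_natCast 2 (L * 2 ^ n), ← Real.rpow_natCast w a, hw, ← Real.rpow_mul (by norm_num),
      ← Real.rpow_add (by norm_num)]
    have : -(L:ℝ) / ((a:ℝ) / 2 ^ n) * a + ((L * 2 ^ n : ℕ) : ℝ) = 0 := by
      push_cast; field_simp; ring
    rw [this, Real.rpow_zero]
  have key : ∀ x : ℕ, x ^ a * 2 ^ (L * 2 ^ n) ≤ 2 ^ (s * a) ↔ (x:ℝ) ≤ 2 ^ s * w := by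
    intro x
    have e : ((2:ℝ) ^ s * w) ^ a * 2 ^ (L * 2 ^ n) = 2 ^ (s * a) := by
      rw [mul_pow, mul_assoc, hwa, mul_one, pow_mul]
    rw [← Nat.cast_le (α := ℝ)]
    push_cast
    rw [← e, mul_le_mul_iff_left₀ (by positivity), pow_le_pow_iff_left₀ (by positivity) (by positivity) ha.ne']
  constructor
  · refine (key _).1 ?_
    exact Nat.findGreatest_spec (P := fun x => x ^ a * 2 ^ (L * 2 ^ n) ≤ 2 ^ (s * a))
      (m := 0) (Nat.zero_le _) (by simp [ha.ne'])
  · by_contra hcon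
    push Not at hcon
    have hle : root (a, n, s) L + 1 ≤ 2 ^ s := by
      have : ((root (a, n, s) L + 1 : ℕ) : ℝ) ≤ ((2 ^ s : ℕ) : ℝ) := by
        push_cast
        calc _ ≤ _ := hcon
          _ ≤ 2 ^ s * 1 := by gcongr
          _ = _ := mul_one _
      exact_mod_cast this
    refine Nat.findGreatest_is_greatest (P := fun x => x ^ a * 2 ^ (L * 2 ^ n) ≤ 2 ^ (s * a))
      (n := 2 ^ s) (k := root (a, n, s) L + 1) (Nat.lt_succ_self _) hle ?_
    rw [key]; push_cast; exact hcon

/-- The finite sum whose sign is certified. -/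
noncomputable def Gl (E t : ℝ) (l : List ℕ) : ℝ :=
  (l.map (fun L : ℕ => ((L:ℝ) - E) * (2:ℝ) ^ (-(L:ℝ) / t))).sum

theorem cert_error (E : ℝ) (hE0 : 0 ≤ E) (c : ℕ) (hc : E + 2 ≤ c) (a n s : ℕ) (ha : 0 < a) (g : ℕ)
    (hg : |E * 2 ^ s - g| ≤ 2) (l : List ℕ) :
    |((2 ^ s * (l.map (fun L => L * root (a, n, s) L)).sum : ℕ) : ℝ)
      - ((g * (l.map (root (a, n, s))).sum : ℕ) : ℝ) - 4 ^ s * Gl E ((a:ℝ) / 2 ^ n) l|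
    ≤ ((2 ^ s * (l.map (fun L => L + c)).sum : ℕ) : ℝ) := by
  induction l with
  | nil => simp [Gl]
  | cons L l ih =>
    have hterm : |(2:ℝ) ^ s * (L * root (a, n, s) L) - g * root (a, n, s) L
        - 4 ^ s * (((L:ℝ) - E) * (2:ℝ) ^ (-(L:ℝ) / ((a:ℝ) / 2 ^ n)))| ≤ 2 ^ s * (L + c) := by
      obtain ⟨h1, h2⟩ := root_spec a n s L ha
      set w := (2:ℝ) ^ (-(L:ℝ) / ((a:ℝ) / 2 ^ n)) with hw
      have ha' : (0:ℝ) < a := by exact_mod_cast ha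
      have hw1 : w ≤ 1 := by
        apply Real.rpow_le_one_of_one_le_of_nonpos (by norm_num)
        rw [neg_div]; exact neg_nonpos.2 (by positivity)
      set r : ℝ := (root (a, n, s) L : ℝ) with hr
      have hr0 : 0 ≤ r := Nat.cast_nonneg _
      have h2s : (0:ℝ) < 2 ^ s := by positivity
      have hr1 : r ≤ 2 ^ s := by nlinarith
      have e4 : (4:ℝ) ^ s = 2 ^ s * 2 ^ s := by rw [← mul_pow]; norm_num
      have e : (2:ℝ) ^ s * (L * r) - g * r - 4 ^ s * (((L:ℝ) - E) * w)
          = (E * 2 ^ s - g) * r + 2 ^ s * ((L - E) * (r - 2 ^ s * w)) := by rw [e4]; ring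
      rw [e]
      have hLE : |(L:ℝ) - E| ≤ L + E := by
        have : (0:ℝ) ≤ L := Nat.cast_nonneg _
        rw [abs_le]; constructor <;> linarith
      have hrw : |r - 2 ^ s * w| ≤ 1 := by rw [abs_le]; constructor <;> linarith
      have b1 : |(E * 2 ^ s - g) * r| ≤ 2 * 2 ^ s := by
        rw [abs_mul, abs_of_nonneg hr0]; gcongr
      have b2 : |2 ^ s * (((L:ℝ) - E) * (r - 2 ^ s * w))| ≤ 2 ^ s * ((L + E) * 1) := by
        rw [abs_mul, abs_mul, abs_of_pos h2s]; gcongr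
      calc _ ≤ _ := abs_add_le _ _
        _ ≤ 2 * 2 ^ s + 2 ^ s * ((L + E) * 1) := add_le_add b1 b2
        _ = 2 ^ s * (L + (E + 2)) := by ring
        _ ≤ _ := by gcongr
    have hG : Gl E ((a:ℝ) / 2 ^ n) (L :: l) =
      ((L:ℝ) - E) * (2:ℝ) ^ (-(L:ℝ) / ((a:ℝ) / 2 ^ n)) + Gl E ((a:ℝ) / 2 ^ n) l := by simp [Gl]
    rw [hG]
    simp only [List.map_cons, List.sum_cons]
    push_cast at ih ⊢
    refine le_trans (le_of_eq ?_) ((abs_add_le _ _).trans ((add_le_add hterm ih).trans (le_of_eq ?_)))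
    · congr 1; ring
    · ring

theorem certP_sound {E : ℝ} (hE0 : 0 ≤ E) {c : ℕ} (hc : E + 2 ≤ c) {a n s : ℕ} (ha : 0 < a) {g : ℕ}
    (hg : |E * 2 ^ s - g| ≤ 2) {l : List ℕ} (h : certP c ((a, n, s), g, l) = true) :
    0 < Gl E ((a:ℝ) / 2 ^ n) l := by
  have h1 := cert_error E hE0 c hc a n s ha g hg l
  simp only [certP, decide_eq_true_eq] at h
  have h' : ((_ : ℕ) : ℝ) < _ := Nat.cast_lt.2 h
  rw [Nat.cast_add] at h'
  rw [abs_le] at h1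
  have : 0 < (4:ℝ) ^ s * Gl E ((a:ℝ) / 2 ^ n) l := by linarith
  exact pos_of_mul_pos_right this (by positivity)

theorem certN_sound {E : ℝ} (hE0 : 0 ≤ E) {c : ℕ} (hc : E + 2 ≤ c) {a n s : ℕ} (ha : 0 < a) {g : ℕ}
    (hg : |E * 2 ^ s - g| ≤ 2) {l : List ℕ} (h : certN c ((a, n, s), g, l) = true) :
    Gl E ((a:ℝ) / 2 ^ n) l < 0 := by
  have h1 := cert_error E hE0 c hc a n s ha g hg l
  simp only [certN, decide_eq_true_eq] at h
  have h' : ((_ : ℕ) : ℝ) < _ := Nat.cast_lt.2 h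
  rw [Nat.cast_add] at h'
  rw [abs_le] at h1
  have : 0 < (4:ℝ) ^ s * (- Gl E ((a:ℝ) / 2 ^ n) l) := by linarith
  have := pos_of_mul_pos_right this (by positivity)
  linarith

theorem eventually_big (x : ℝ) (hx : 0 < x) (b : ℝ) : ∀ᶠ s : ℕ in atTop, 2 ^ s * b < 4 ^ s * x := by
  have : ∀ᶠ s : ℕ in atTop, b / x < 2 ^ s :=
    (tendsto_pow_atTop_atTop_of_one_lt (by norm_num : (1:ℝ) < 2)).eventually_gt_atTop _
  filter_upwards [this] with s hs
  have e4 : (4:ℝ) ^ s = 2 ^ s * 2 ^ s := by rw [← mul_pow]; norm_num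
  rw [e4, mul_assoc]
  rw [div_lt_iff₀ hx] at hs
  gcongr

theorem certP_complete {E : ℝ} (hE0 : 0 ≤ E) {c : ℕ} (hc : E + 2 ≤ c) {a n : ℕ} (ha : 0 < a)
    {g : ℕ → ℕ} (hg : ∀ s, |E * 2 ^ s - g s| ≤ 2) {l : List ℕ} (h : 0 < Gl E ((a:ℝ) / 2 ^ n) l) :
    ∀ᶠ s in atTop, certP c ((a, n, s), g s, l) = true := by
  filter_upwards [eventually_big _ h (2 * ((l.map (fun L => L + c)).sum : ℕ))] with s hs
  have h1 := cert_error E hE0 c hc a n s ha (g s) (hg s) l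
  simp only [certP, decide_eq_true_eq]
  rw [← Nat.cast_lt (α := ℝ), Nat.cast_add]
  rw [abs_le] at h1
  have e : ((2 ^ s * (l.map (fun L => L + c)).sum : ℕ) : ℝ) =
    2 ^ s * ((l.map (fun L => L + c)).sum : ℕ) := by push_cast; ring
  rw [e] at h1 ⊢
  linarith [h1.1]

theorem certN_complete {E : ℝ} (hE0 : 0 ≤ E) {c : ℕ} (hc : E + 2 ≤ c) {a n : ℕ} (ha : 0 < a)
    {g : ℕ → ℕ} (hg : ∀ s, |E * 2 ^ s - g s| ≤ 2) {l : List ℕ} (h : Gl E ((a:ℝ) / 2 ^ n) l < 0) :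
    ∀ᶠ s in atTop, certN c ((a, n, s), g s, l) = true := by
  filter_upwards [eventually_big _ (neg_pos.2 h) (2 * ((l.map (fun L => L + c)).sum : ℕ))] with s hs
  have h1 := cert_error E hE0 c hc a n s ha (g s) (hg s) l
  simp only [certN, decide_eq_true_eq]
  rw [← Nat.cast_lt (α := ℝ), Nat.cast_add]
  rw [abs_le] at h1
  have e : ((2 ^ s * (l.map (fun L => L + c)).sum : ℕ) : ℝ) =
    2 ^ s * ((l.map (fun L => L + c)).sum : ℕ) := by push_cast; ring
  rw [e] at h1 ⊢
  linarith [h1.2]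

theorem Computer.exists_stages (V : Computer) :
    ∃ (D : ℕ → List (List Bool)) (O : ℕ → ℕ), Primrec D ∧ Primrec O ∧ (∀ k, (D k).Nodup) ∧
      (∀ j k, j ≤ k → D j ⊆ D k) ∧ (∀ p, p ∈ V.f.Dom ↔ ∃ k, p ∈ D k) ∧
      (∀ k, ∀ p ∈ D k, ∀ y ∈ V.f p, y.length < O k) := by
  obtain ⟨c, hc⟩ := Nat.Partrec.Code.exists_code.1 V.partrec
  have hcodeEq : ∀ p : List Bool, c.eval (Encodable.encode p) = (V.f p).map Encodable.encode := by
    intro p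
    rw [hc]
    simp
  have hev : Primrec₂ fun (k : ℕ) (n : ℕ) => Nat.Partrec.Code.evaln k c n :=
    (Nat.Partrec.Code.primrec_evaln.comp
      ((Primrec.fst.pair (Primrec.const c)).pair Primrec.snd)).to₂
  let D : ℕ → List (List Bool) := fun k => (List.range k).filterMap (fun n =>
    (Nat.Partrec.Code.evaln k c n).bind (fun _ => Encodable.decode₂ (List Bool) n))
  let O : ℕ → ℕ := fun k => ((List.range k).map (fun n =>
    ((((Nat.Partrec.Code.evaln k c n).bind
      (fun m => (Encodable.decode m : Option (List Bool)))).getD []).length))).sum + 1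
  have hmem : ∀ k p, p ∈ D k ↔ ∃ m, m ∈ Nat.Partrec.Code.evaln k c (Encodable.encode p) := by
    intro k p
    simp only [D, List.mem_filterMap, List.mem_range, Option.bind_eq_some_iff]
    constructor
    · rintro ⟨n, -, m, hm, hd⟩
      have : Encodable.encode p = n := Encodable.mem_decode₂.1 hd
      subst this
      exact ⟨m, hm⟩
    · rintro ⟨m, hm⟩
      exact ⟨Encodable.encode p, Nat.Partrec.Code.evaln_bound hm, m, hm, Encodable.mem_decode₂.2 rfl⟩
  refine ⟨D, O, ?_, ?_, ?_, ?_, ?_, ?_⟩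
  · have h1 : Primrec₂ fun (k : ℕ) (n : ℕ) => (Nat.Partrec.Code.evaln k c n).bind
        (fun _ => Encodable.decode₂ (List Bool) n) :=
      Primrec.option_bind (f := fun q : ℕ × ℕ => Nat.Partrec.Code.evaln q.1 c q.2)
        (g := fun q (_ : ℕ) => Encodable.decode₂ (List Bool) q.2) hev
        (Primrec.decode₂.comp (Primrec.snd.comp Primrec.fst)).to₂
    exact Primrec.listFilterMap Primrec.list_range h1
  · have h1 : Primrec₂ fun (k : ℕ) (n : ℕ) => ((((Nat.Partrec.Code.evaln k c n).bind
        (fun m => (Encodable.decode m : Option (List Bool)))).getD []).length) := by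
      have h2 := Primrec.option_bind (f := fun q : ℕ × ℕ => Nat.Partrec.Code.evaln q.1 c q.2)
        (g := fun q (m : ℕ) => (Encodable.decode m : Option (List Bool))) hev
        (Primrec.decode.comp Primrec.snd).to₂
      exact Primrec.list_length.comp (Primrec.option_getD.comp h2 (Primrec.const []))
    exact Primrec.succ.comp (primrec_sum_map Primrec.list_range h1)
  · intro k
    refine List.Nodup.filterMap ?_ List.nodup_range
    intro a a' b hb hb'
    simp only [Option.mem_def, Option.bind_eq_some_iff] at hb hb'
    obtain ⟨_, _, h⟩ := hb
    obtain ⟨_, _, h'⟩ := hb'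
    rw [← Encodable.mem_decode₂.1 h, ← Encodable.mem_decode₂.1 h']
  · intro j k hjk p hp
    obtain ⟨m, hm⟩ := (hmem _ _).1 hp
    exact (hmem _ _).2 ⟨m, Nat.Partrec.Code.evaln_mono hjk hm⟩
  · intro p
    simp only [hmem]
    rw [exists_comm]
    simp only [← Nat.Partrec.Code.evaln_complete, hcodeEq]
    constructor
    · intro h
      obtain ⟨y, hy⟩ := Part.dom_iff_mem.1 h
      exact ⟨_, Part.mem_map _ hy⟩
    · rintro ⟨m, hm⟩
      obtain ⟨y, hy, -⟩ := (Part.mem_map_iff _).1 hm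
      exact Part.dom_iff_mem.2 ⟨y, hy⟩
  · intro k p hp y hy
    obtain ⟨m, hm⟩ := (hmem _ _).1 hp
    have hm' : m ∈ c.eval (Encodable.encode p) := Nat.Partrec.Code.evaln_sound hm
    rw [hcodeEq] at hm'
    obtain ⟨y', hy', rfl⟩ := (Part.mem_map_iff _).1 hm'
    have : y = y' := Part.mem_unique hy hy'
    subst this
    refine Nat.lt_succ_of_le (List.le_sum_of_mem ?_)
    refine List.mem_map.2 ⟨Encodable.encode p, List.mem_range.2 (Nat.Partrec.Code.evaln_bound hm), ?_⟩
    rw [Option.mem_def] at hm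
    simp [hm]

/-- Kraft's inequality for finite prefix-free sets. -/
theorem kraft (S : Finset (List Bool)) (h : PrefixFree (S : Set (List Bool))) :
    ∑ p ∈ S, (1 / 2 : ℝ) ^ p.length ≤ 1 := by
  classical
  set M := S.sup List.length with hM
  have hle : ∀ p ∈ S, p.length ≤ M := fun p hp => Finset.le_sup (f := List.length) hp
  let ext : List Bool → Finset (List Bool) := fun p =>
    (Finset.univ : Finset (Fin (M - p.length) → Bool)).image (fun v => p ++ List.ofFn v)
  have hcard : ∀ p, (ext p).card = 2 ^ (M - p.length) := by
    intro p
    rw [Finset.card_image_of_injective]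
    · simp
    · intro v w hvw
      exact List.ofFn_injective (List.append_cancel_left hvw)
  have hdisj : ∀ p ∈ S, ∀ q ∈ S, p ≠ q → Disjoint (ext p) (ext q) := by
    intro p hp q hq hpq
    rw [Finset.disjoint_left]
    intro x hx hx'
    simp only [ext, Finset.mem_image, Finset.mem_univ, true_and] at hx hx'
    obtain ⟨v, rfl⟩ := hx
    obtain ⟨w, hw⟩ := hx'
    have h1 : p <+: p ++ List.ofFn v := List.prefix_append _ _
    have h2 : q <+: p ++ List.ofFn v := hw ▸ List.prefix_append _ _
    rcases List.prefix_or_prefix_of_prefix h1 h2 with h3 | h3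
    · exact hpq (h p hp q hq h3)
    · exact hpq (h q hq p hp h3).symm
  have hsub : S.biUnion ext ⊆
      (Finset.univ : Finset (Fin M → Bool)).image (fun v => List.ofFn v) := by
    intro x hx
    simp only [ext, Finset.mem_biUnion, Finset.mem_image, Finset.mem_univ, true_and] at hx ⊢
    obtain ⟨p, hp, v, rfl⟩ := hx
    have hl : (p ++ List.ofFn v).length = M := by
      have := hle p hp
      simp; omega
    refine ⟨fun i => (p ++ List.ofFn v).get (i.cast hl.symm), ?_⟩
    apply List.ext_get
    · simpa using hl.symm
    · intro i h1 h2
      simp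
  have hN : ∑ p ∈ S, 2 ^ (M - p.length) ≤ 2 ^ M := by
    calc ∑ p ∈ S, 2 ^ (M - p.length) = ∑ p ∈ S, (ext p).card := by simp only [hcard]
      _ = (S.biUnion ext).card := (Finset.card_biUnion hdisj).symm
      _ ≤ _ := Finset.card_le_card hsub
      _ ≤ _ := Finset.card_image_le
      _ = 2 ^ M := by simp
  have hR : ∑ p ∈ S, (2:ℝ) ^ (M - p.length) ≤ 2 ^ M := by exact_mod_cast hN
  have : ∑ p ∈ S, (1 / 2 : ℝ) ^ p.length = (∑ p ∈ S, (2:ℝ) ^ (M - p.length)) / 2 ^ M := by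
    rw [Finset.sum_div]
    refine Finset.sum_congr rfl fun p hp => ?_
    rw [pow_sub₀ _ (by norm_num) (hle p hp)]
    field_simp
    rw [← mul_pow]; norm_num
  rw [this, div_le_one (by positivity)]
  exact hR

theorem Computer.summable_half (V : Computer) :
    Summable (fun p : V.f.Dom => (1 / 2 : ℝ) ^ p.1.length) ∧
    ∑' p : V.f.Dom, (1 / 2 : ℝ) ^ p.1.length ≤ 1 := by
  classical
  have hb : ∀ s : Finset V.f.Dom, ∑ p ∈ s, (1 / 2 : ℝ) ^ p.1.length ≤ 1 := by
    intro s
    have := kraft (s.map (Function.Embedding.subtype _)) ?_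
    · simpa using this
    · intro p hp q hq hpq
      simp only [Finset.coe_map, Set.mem_image] at hp hq
      obtain ⟨p', -, rfl⟩ := hp
      obtain ⟨q', -, rfl⟩ := hq
      exact V.dom_prefixFree _ p'.2 _ q'.2 hpq
  have hs := summable_of_sum_le (fun p : V.f.Dom => by positivity) hb
  exact ⟨hs, hs.tsum_le_of_sum_le hb⟩

noncomputable def phi (x t : ℝ) : ℝ := x * (2:ℝ) ^ (-x / t)

theorem two_rpow_eq (x : ℝ) : (2:ℝ) ^ x = Real.exp (Real.log 2 * x) :=
  Real.rpow_def_of_pos (by norm_num) x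

theorem log2_pos : 0 < Real.log 2 := Real.log_pos (by norm_num)

theorem phi_lower (x s t : ℝ) (hs : 0 < s) (hst : s ≤ t) :
    Real.log 2 * (1 / s - 1 / t) * x ^ 2 * (2:ℝ) ^ (-|x| / s) ≤ phi x t - phi x s := by
  have ht : 0 < t := hs.trans_le hst
  have hd : 0 ≤ 1 / s - 1 / t := sub_nonneg.2 (one_div_le_one_div_of_le hs hst)
  set y := Real.log 2 * (x * (1 / s - 1 / t)) with hy
  have e1 : (2:ℝ) ^ (-x / t) = (2:ℝ) ^ (-x / s) * Real.exp y := by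
    rw [two_rpow_eq, two_rpow_eq, ← Real.exp_add]; congr 1; rw [hy]; ring
  have e2 : (2:ℝ) ^ (-x / s) = (2:ℝ) ^ (-x / t) * Real.exp (-y) := by
    rw [two_rpow_eq, two_rpow_eq, ← Real.exp_add]; congr 1; rw [hy]; ring
  have hl := log2_pos
  rcases le_total 0 x with hx | hx
  · rw [abs_of_nonneg hx]
    unfold phi
    rw [e1]
    have h1 := Real.add_one_le_exp y
    have hp : 0 < (2:ℝ) ^ (-x / s) := by positivity
    have : x * (2:ℝ) ^ (-x / s) * y ≤ x * (2:ℝ) ^ (-x / s) * (Real.exp y - 1) := by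
      gcongr; linarith
    calc _ = x * (2:ℝ) ^ (-x / s) * y := by rw [hy]; ring
      _ ≤ _ := this
      _ = _ := by ring
  · have h1 := Real.add_one_le_exp (-y)
    have hp : 0 < (2:ℝ) ^ (-x / t) := by positivity
    have hle : (2:ℝ) ^ (-|x| / s) ≤ (2:ℝ) ^ (-x / t) := by
      apply Real.rpow_le_rpow_of_exponent_le (by norm_num)
      have a1 : -|x| / s ≤ 0 := by
        rw [neg_div]; exact neg_nonpos.2 (by positivity)
      have a2 : 0 ≤ -x / t := div_nonneg (by linarith) ht.le
      linarith
    have h3 : x * (2:ℝ) ^ (-x / t) * y ≤ x * (2:ℝ) ^ (-x / t) * (1 - Real.exp (-y)) := by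
      have hneg : x * (2:ℝ) ^ (-x / t) ≤ 0 := mul_nonpos_of_nonpos_of_nonneg hx hp.le
      exact mul_le_mul_of_nonpos_left (by linarith) hneg
    have h4 : phi x t - phi x s = x * (2:ℝ) ^ (-x / t) * (1 - Real.exp (-y)) := by
      unfold phi
      rw [e2]; ring
    rw [h4]
    calc _ ≤ Real.log 2 * (1 / s - 1 / t) * x ^ 2 * (2:ℝ) ^ (-x / t) := by gcongr
      _ = x * (2:ℝ) ^ (-x / t) * y := by rw [hy]; ring
      _ ≤ _ := h3

theorem phi_upper (x s t : ℝ) (hs : 0 < s) (hst : s ≤ t) :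
    phi x t - phi x s ≤
      Real.log 2 * (1 / s - 1 / t) * x ^ 2 * ((2:ℝ) ^ (-x / t) + (2:ℝ) ^ (-x / s)) := by
  have ht : 0 < t := hs.trans_le hst
  have hd : 0 ≤ 1 / s - 1 / t := sub_nonneg.2 (one_div_le_one_div_of_le hs hst)
  set y := Real.log 2 * (x * (1 / s - 1 / t)) with hy
  have e1 : (2:ℝ) ^ (-x / t) = (2:ℝ) ^ (-x / s) * Real.exp y := by
    rw [two_rpow_eq, two_rpow_eq, ← Real.exp_add]; congr 1; rw [hy]; ring
  have e2 : (2:ℝ) ^ (-x / s) = (2:ℝ) ^ (-x / t) * Real.exp (-y) := by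
    rw [two_rpow_eq, two_rpow_eq, ← Real.exp_add]; congr 1; rw [hy]; ring
  have hl := log2_pos
  have hp : 0 < (2:ℝ) ^ (-x / t) := by positivity
  have hp' : 0 < (2:ℝ) ^ (-x / s) := by positivity
  have hnn : 0 ≤ Real.log 2 * (1 / s - 1 / t) * x ^ 2 := by positivity
  rcases le_total 0 x with hx | hx
  · have h1 := Real.add_one_le_exp (-y)
    have h4 : phi x t - phi x s = x * (2:ℝ) ^ (-x / t) * (1 - Real.exp (-y)) := by
      unfold phi
      rw [e2]; ring
    rw [h4]
    calc _ ≤ x * (2:ℝ) ^ (-x / t) * y := by gcongr; linarith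
      _ = Real.log 2 * (1 / s - 1 / t) * x ^ 2 * (2:ℝ) ^ (-x / t) := by rw [hy]; ring
      _ ≤ _ := by gcongr; linarith
  · have h1 := Real.add_one_le_exp y
    have h4 : phi x t - phi x s = x * (2:ℝ) ^ (-x / s) * (Real.exp y - 1) := by
      unfold phi
      rw [e1]; ring
    rw [h4]
    have hneg : x * (2:ℝ) ^ (-x / s) ≤ 0 := mul_nonpos_of_nonpos_of_nonneg hx hp'.le
    calc _ ≤ x * (2:ℝ) ^ (-x / s) * y := mul_le_mul_of_nonpos_left (by linarith) hneg
      _ = Real.log 2 * (1 / s - 1 / t) * x ^ 2 * (2:ℝ) ^ (-x / s) := by rw [hy]; ring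
      _ ≤ _ := by gcongr; linarith

theorem phi_eq (L E t : ℝ) : phi (L - E) t = (2:ℝ) ^ (E / t) * ((L - E) * (2:ℝ) ^ (-L / t)) := by
  unfold phi
  have : -(L - E) / t = E / t + -L / t := by ring
  rw [this, Real.rpow_add (by norm_num)]; ring

theorem boltz_eq (L : ℕ) (t : ℝ) :
    (2:ℝ) ^ (-(L:ℝ) / t) = (1 / 2 : ℝ) ^ L * ((2:ℝ) ^ (1 - 1 / t)) ^ L := by
  have h : (1 / 2 : ℝ) = (2:ℝ) ^ (-1 : ℝ) := by rw [Real.rpow_neg_one]; norm_num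
  rw [h, ← Real.rpow_natCast, ← Real.rpow_natCast, ← Real.rpow_mul (by norm_num),
    ← Real.rpow_mul (by norm_num), ← Real.rpow_add (by norm_num)]
  congr 1; ring

theorem rr_lt_one {t : ℝ} (ht : t ∈ Set.Ioo (0:ℝ) 1) :
    0 < (2:ℝ) ^ (1 - 1 / t) ∧ (2:ℝ) ^ (1 - 1 / t) < 1 := by
  refine ⟨by positivity, Real.rpow_lt_one_of_one_lt_of_neg (by norm_num) ?_⟩
  have := (one_lt_div ht.1).2 ht.2
  linarith

theorem pow_mul_bounded (j : ℕ) {r : ℝ} (h0 : 0 < r) (h1 : r < 1) :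
    ∃ K : ℝ, 0 ≤ K ∧ ∀ n : ℕ, (n:ℝ) ^ j * r ^ n ≤ K := by
  have := tendsto_pow_const_mul_const_pow_of_abs_lt_one j (r := r) (by rwa [abs_of_pos h0])
  obtain ⟨K, hK⟩ := this.bddAbove_range
  refine ⟨max K 0, le_max_right _ _, fun n => le_max_of_le_left (hK ⟨n, rfl⟩)⟩

section
variable {ι : Type*} {L : ι → ℕ}

theorem summable_boltz (hs : Summable fun p => (1 / 2 : ℝ) ^ L p) (j : ℕ) {t : ℝ} (ht : t ∈ Set.Ioo (0:ℝ) 1) :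
    Summable fun p => (L p : ℝ) ^ j * (2:ℝ) ^ (-(L p : ℝ) / t) := by
  obtain ⟨h0, h1⟩ := rr_lt_one ht
  obtain ⟨K, hK0, hK⟩ := pow_mul_bounded j h0 h1
  refine Summable.of_nonneg_of_le (fun p => by positivity) (fun p => ?_) (hs.mul_left K)
  rw [boltz_eq]
  calc _ = (L p : ℝ) ^ j * ((2:ℝ) ^ (1 - 1 / t)) ^ L p * (1 / 2 : ℝ) ^ L p := by ring
    _ ≤ _ := by gcongr; exact hK _

theorem upper_lip {E T : ℝ} (hs : Summable fun p => (1 / 2 : ℝ) ^ L p) (hE0 : 0 ≤ E) (hT : T ∈ Set.Ioo (0:ℝ) 1) :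
    ∃ B C : ℝ, T < B ∧ B < 1 ∧ 0 ≤ C ∧ ∀ t, T ≤ t → t ≤ B → ∀ S : Finset ι,
      ∑ p ∈ S, phi (L p - E) t - ∑ p ∈ S, phi (L p - E) T ≤ C * (t - T) := by
  obtain ⟨B, hTB, hB1⟩ := exists_between hT.2
  have hB : B ∈ Set.Ioo (0:ℝ) 1 := ⟨hT.1.trans hTB, hB1⟩
  have hT0 := hT.1
  have hS : Summable fun p => ((L p : ℝ) - E) ^ 2 * (2:ℝ) ^ (-(L p : ℝ) / B) := by
    have := ((summable_boltz hs 2 hB).sub ((summable_boltz hs 1 hB).mul_left (2 * E))).add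
      ((summable_boltz hs 0 hB).mul_left (E ^ 2))
    refine this.congr fun p => ?_
    ring
  set M := ∑' p, ((L p : ℝ) - E) ^ 2 * (2:ℝ) ^ (-(L p : ℝ) / B) with hM
  have hM0 : 0 ≤ M := tsum_nonneg fun p => by positivity
  have hl := log2_pos
  refine ⟨B, Real.log 2 * (1 / T ^ 2) * (2 * (2:ℝ) ^ (E / T) * M), hTB, hB1, by positivity, ?_⟩
  intro t hTt htB S
  have ht : 0 < t := hT0.trans_le hTt
  rw [← Finset.sum_sub_distrib]
  have hd : 0 ≤ 1 / T - 1 / t := sub_nonneg.2 (one_div_le_one_div_of_le hT0 hTt)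
  have hd2 : 1 / T - 1 / t ≤ 1 / T ^ 2 * (t - T) := by
    have : 1 / T - 1 / t = (t - T) / (T * t) := by field_simp
    rw [this, one_div_mul_eq_div]
    apply div_le_div_of_nonneg_left (by linarith) (by positivity)
    nlinarith
  have hb : ∀ u, T ≤ u → u ≤ B → ∀ p : ι,
      (2:ℝ) ^ (-((L p : ℝ) - E) / u) ≤ (2:ℝ) ^ (E / T) * (2:ℝ) ^ (-(L p : ℝ) / B) := by
    intro u hu1 hu2 p
    have hu : 0 < u := hT0.trans_le hu1
    rw [← Real.rpow_add (by norm_num)]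
    apply Real.rpow_le_rpow_of_exponent_le (by norm_num)
    have a1 : E / u ≤ E / T := div_le_div_of_nonneg_left hE0 hT0 hu1
    have a2 : (L p : ℝ) / B ≤ (L p : ℝ) / u := div_le_div_of_nonneg_left (by positivity) hu hu2
    have a3 : -((L p : ℝ) - E) / u = E / u - L p / u := by ring
    rw [a3, neg_div]; linarith
  calc _ ≤ ∑ p ∈ S, Real.log 2 * (1 / T ^ 2 * (t - T)) * (2 * (2:ℝ) ^ (E / T)) *
        (((L p : ℝ) - E) ^ 2 * (2:ℝ) ^ (-(L p : ℝ) / B)) := by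
        refine Finset.sum_le_sum fun p _ => (phi_upper _ _ _ hT0 hTt).trans ?_
        have e1 := hb t hTt htB p
        have e2 := hb T le_rfl hTB.le p
        calc _ ≤ Real.log 2 * (1 / T ^ 2 * (t - T)) * ((L p : ℝ) - E) ^ 2 *
              ((2:ℝ) ^ (E / T) * (2:ℝ) ^ (-(L p : ℝ) / B) + (2:ℝ) ^ (E / T) * (2:ℝ) ^ (-(L p : ℝ) / B)) := by
              gcongr
          _ = _ := by ring
    _ = Real.log 2 * (1 / T ^ 2 * (t - T)) * (2 * (2:ℝ) ^ (E / T)) *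
        ∑ p ∈ S, (((L p : ℝ) - E) ^ 2 * (2:ℝ) ^ (-(L p : ℝ) / B)) := by rw [Finset.mul_sum]
    _ ≤ Real.log 2 * (1 / T ^ 2 * (t - T)) * (2 * (2:ℝ) ^ (E / T)) * M := by
        have : 0 ≤ t - T := by linarith
        gcongr
        exact hS.sum_le_tsum S fun p _ => by positivity
    _ = _ := by ring

theorem tail_bound {E T : ℝ} (hs : Summable fun p => (1 / 2 : ℝ) ^ L p) (hE0 : 0 ≤ E) (hT : T ∈ Set.Ioo (0:ℝ) 1) :
    ∃ K : ℝ, 0 ≤ K ∧ ∀ (S : Finset ι) (m : ℕ), (∀ p, (L p : ℝ) ≤ E → p ∈ S) →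
      ∑' p, (1 / 2 : ℝ) ^ L p - ∑ p ∈ S, (1 / 2 : ℝ) ^ L p ≤ (1 / 2) ^ m →
      HasSum (fun p => phi (L p - E) T) 0 →
      - ∑ p ∈ S, phi (L p - E) T ≤ K * (m + 1) * (2:ℝ) ^ (-(m:ℝ) / T) := by
  obtain ⟨h0, h1⟩ := rr_lt_one hT
  obtain ⟨K, hK0, hK⟩ := pow_mul_bounded 1 h0 h1
  set r := (2:ℝ) ^ (1 - 1 / T) with hr
  refine ⟨(2:ℝ) ^ (E / T) * (K + 1), by positivity, ?_⟩
  intro S m hS hm hsum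
  have e1 := hsum.summable.sum_add_tsum_compl (s := S)
  rw [hsum.tsum_eq] at e1
  have e2 := hs.sum_add_tsum_compl (s := S)
  have hs' : Summable fun p : ↑((S : Set ι)ᶜ) => (1 / 2 : ℝ) ^ L p.1 := hs.subtype _
  have htail : ∑' p : ↑((S : Set ι)ᶜ), (1 / 2 : ℝ) ^ L p.1 ≤ (1 / 2) ^ m := by linarith
  have hLm : ∀ p : ↑((S : Set ι)ᶜ), m ≤ L p.1 := by
    intro p
    have : (1 / 2 : ℝ) ^ L p.1 ≤ (1 / 2) ^ m :=
      (hs'.le_tsum p fun q _ => by positivity).trans htail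
    exact (pow_le_pow_iff_right_of_lt_one₀ (by norm_num) (by norm_num)).1 this
  have hterm : ∀ p : ↑((S : Set ι)ᶜ), phi (L p.1 - E) T ≤
      (2:ℝ) ^ (E / T) * ((m + K) * r ^ m) * (1 / 2 : ℝ) ^ L p.1 := by
    intro p
    rw [phi_eq, boltz_eq, ← hr]
    obtain ⟨j, hj⟩ := Nat.exists_eq_add_of_le (hLm p)
    have a : ((L p.1 : ℝ) - E) * r ^ L p.1 ≤ (m + K) * r ^ m := by
      calc ((L p.1 : ℝ) - E) * r ^ L p.1 ≤ (L p.1 : ℝ) * r ^ L p.1 := by gcongr; linarith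
        _ = r ^ m * (m * r ^ j + (j:ℝ) ^ 1 * r ^ j) := by rw [hj, pow_add]; push_cast; ring
        _ ≤ r ^ m * (m * 1 + K) := by
            gcongr
            · exact pow_le_one₀ h0.le h1.le
            · exact hK j
        _ = _ := by ring
    calc _ = (2:ℝ) ^ (E / T) * (((L p.1 : ℝ) - E) * r ^ L p.1) * (1 / 2 : ℝ) ^ L p.1 := by ring
      _ ≤ _ := by gcongr
  have hle := Summable.tsum_le_tsum hterm (hsum.summable.subtype _) (hs'.mul_left _)
  rw [tsum_mul_left] at hle
  have e3 : - ∑ p ∈ S, phi (L p - E) T = ∑' p : ↑((S : Set ι)ᶜ), phi (L p.1 - E) T := by linarith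
  rw [e3]
  refine hle.trans ?_
  calc _ ≤ (2:ℝ) ^ (E / T) * ((m + K) * r ^ m) * (1 / 2) ^ m := by gcongr
    _ = (2:ℝ) ^ (E / T) * (m + K) * (2:ℝ) ^ (-(m:ℝ) / T) := by rw [boltz_eq]; ring
    _ ≤ (2:ℝ) ^ (E / T) * ((K + 1) * (m + 1)) * (2:ℝ) ^ (-(m:ℝ) / T) := by
        gcongr
        have : (0:ℝ) ≤ m := by positivity
        nlinarith
    _ = _ := by ring
end

section
variable {ι : Type*} {L : ι → ℕ} {E T : ℝ}

theorem tail_term (hT : 0 < T) (hsum : HasSum (fun p => phi (L p - E) T) 0) (S : Finset ι)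
    (hS : ∀ p, (L p : ℝ) ≤ E → p ∈ S) :
    (∑ p ∈ S, phi (L p - E) T ≤ 0) ∧
    ∀ q, q ∉ S → phi (L q - E) T ≤ - ∑ p ∈ S, phi (L p - E) T := by
  classical
  have hnn : ∀ p, p ∉ S → 0 ≤ phi (L p - E) T := by
    intro p hp
    have : E < L p := by
      by_contra h
      exact hp (hS p (not_lt.1 h))
    unfold phi
    have : 0 < (L p : ℝ) - E := by linarith
    positivity
  constructor
  · exact sum_le_hasSum S hnn hsum
  · intro q hq
    have := sum_le_hasSum (insert q S) (fun p hp => hnn p fun h => hp (Finset.mem_insert_of_mem h)) hsum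
    rw [Finset.sum_insert hq] at this
    linarith

theorem sum_phi_mono (S : Finset ι) {s t : ℝ} (hs : 0 < s) (hst : s ≤ t) (p₀ : ι) (hp : p₀ ∈ S) :
    Real.log 2 * (1 / s - 1 / t) * ((L p₀ : ℝ) - E) ^ 2 * (2:ℝ) ^ (-|(L p₀ : ℝ) - E| / s) ≤
    ∑ p ∈ S, phi (L p - E) t - ∑ p ∈ S, phi (L p - E) s := by
  have hl := log2_pos
  have hd : 0 ≤ 1 / s - 1 / t := sub_nonneg.2 (one_div_le_one_div_of_le hs hst)
  rw [← Finset.sum_sub_distrib]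
  refine (phi_lower _ _ _ hs hst).trans ?_
  refine Finset.single_le_sum (f := fun p => phi (L p - E) t - phi (L p - E) s) (fun p _ => ?_) hp
  exact le_trans (by positivity) (phi_lower _ _ _ hs hst)

theorem sum_phi_strictMono (S : Finset ι) {s t : ℝ} (hs : 0 < s) (hst : s < t) (p₀ : ι) (hp : p₀ ∈ S)
    (hne : (L p₀ : ℝ) ≠ E) :
    ∑ p ∈ S, phi (L p - E) s < ∑ p ∈ S, phi (L p - E) t := by
  have h := sum_phi_mono (L := L) (E := E) S hs hst.le p₀ hp
  have hl := log2_pos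
  have hd : 0 < 1 / s - 1 / t := sub_pos.2 (one_div_lt_one_div_of_lt hs hst)
  have h2 : 0 < ((L p₀ : ℝ) - E) ^ 2 := by
    have : (L p₀ : ℝ) - E ≠ 0 := sub_ne_zero.2 hne
    positivity
  have : 0 < Real.log 2 * (1 / s - 1 / t) * ((L p₀ : ℝ) - E) ^ 2 * (2:ℝ) ^ (-|(L p₀ : ℝ) - E| / s) := by
    positivity
  linarith

theorem lower_lip (hT : T ∈ Set.Ioo (0:ℝ) 1) (p₀ : ι) (hne : (L p₀ : ℝ) ≠ E) :
    ∃ c : ℝ, 0 < c ∧ ∀ t, T ≤ t → t ≤ 1 → ∀ S : Finset ι, p₀ ∈ S →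
      c * (t - T) ≤ ∑ p ∈ S, phi (L p - E) t - ∑ p ∈ S, phi (L p - E) T := by
  have hl := log2_pos
  have hT0 := hT.1
  have h2 : 0 < ((L p₀ : ℝ) - E) ^ 2 := by
    have : (L p₀ : ℝ) - E ≠ 0 := sub_ne_zero.2 hne
    positivity
  refine ⟨Real.log 2 * (1 / T) * ((L p₀ : ℝ) - E) ^ 2 * (2:ℝ) ^ (-|(L p₀ : ℝ) - E| / T),
    by positivity, ?_⟩
  intro t hTt ht1 S hp
  refine le_trans ?_ (sum_phi_mono (L := L) (E := E) S hT.1 hTt p₀ hp)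
  have ht : 0 < t := hT.1.trans_le hTt
  have : 1 / T * (t - T) ≤ 1 / T - 1 / t := by
    have e : 1 / T - 1 / t = (t - T) / (T * t) := by field_simp
    rw [e, one_div_mul_eq_div]
    apply div_le_div_of_nonneg_left (by linarith) (by positivity)
    nlinarith
  calc _ = Real.log 2 * (1 / T * (t - T)) * ((L p₀ : ℝ) - E) ^ 2 * (2:ℝ) ^ (-|(L p₀ : ℝ) - E| / T) := by ring
    _ ≤ _ := by gcongr

theorem continuousOn_sum_phi (S : Finset ι) :
    ContinuousOn (fun t => ∑ p ∈ S, phi (L p - E) t) (Set.Ioi 0) := by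
  refine continuousOn_finsetSum _ fun p _ => ?_
  unfold phi
  refine continuousOn_const.mul ?_
  refine ContinuousOn.rpow continuousOn_const ?_ (fun _ _ => Or.inl (by norm_num))
  exact continuousOn_const.div continuousOn_id fun t ht => ne_of_gt ht
end

/-- The `m`-bit binary representation of `v`. -/
def bits (q : ℕ × ℕ) : List Bool :=
  (List.range q.2).map fun i => decide (q.1 / 2 ^ (q.2 - 1 - i) % 2 = 1)

/-- The value of a binary string. -/
def val (x : List Bool) : ℕ := x.foldl (fun v b => 2 * v + b.toNat) 0

theorem length_bits (v m : ℕ) : (bits (v, m)).length = m := by simp [bits]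

theorem bits_succ (v m : ℕ) : bits (v, m + 1) = bits (v / 2, m) ++ [decide (v % 2 = 1)] := by
  unfold bits
  simp only [List.range_succ, List.map_append, List.map_cons, List.map_nil]
  congr 1
  · apply List.map_congr_left
    intro i hi
    rw [List.mem_range] at hi
    have : m + 1 - 1 - i = (m - 1 - i) + 1 := by omega
    rw [this, pow_succ', ← Nat.div_div_eq_div_mul]
  · simp

theorem val_bits (m : ℕ) : ∀ v, v < 2 ^ m → val (bits (v, m)) = v := by
  induction m with
  | zero => intro v hv; simp at hv; subst hv; rfl
  | succ m ih =>
    intro v hv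
    rw [bits_succ]
    have h := ih (v / 2) (by rw [pow_succ] at hv; omega)
    unfold val at h ⊢
    rw [List.foldl_append, h]
    simp only [List.foldl_cons, List.foldl_nil]
    rcases Nat.mod_two_eq_zero_or_one v with h | h <;> simp [h] <;> omega

theorem firstBits_eq {T : ℝ} (hT : T ∈ Set.Ioo (0:ℝ) 1) (n : ℕ) :
    firstBits T n = bits (⌊T * 2 ^ n⌋₊, n) := by
  unfold firstBits bits
  apply List.map_congr_left
  intro i hi
  rw [List.mem_range] at hi
  unfold bitOf
  have h0 : ⌊T⌋ = 0 := Int.floor_eq_zero_iff.2 ⟨hT.1.le, hT.2⟩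
  have hT0 := hT.1
  have h1 : ⌊T * 2 ^ (i + 1)⌋ = ((⌊T * 2 ^ n⌋₊ / 2 ^ (n - 1 - i) : ℕ) : ℤ) := by
    have : T * 2 ^ (i + 1) = T * 2 ^ n / ((2 ^ (n - 1 - i) : ℕ) : ℝ) := by
      obtain ⟨k, rfl⟩ : ∃ k, n = i + 1 + k := ⟨n - (i + 1), by omega⟩
      have : i + 1 + k - 1 - i = k := by omega
      rw [this]; push_cast; field_simp; ring
    rw [← Nat.floor_div_natCast, ← this, Int.natCast_floor_eq_floor (by positivity)]
  rw [h0, Int.cast_zero, sub_zero, h1]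
  norm_cast

theorem floor_lt {T : ℝ} (hT : T ∈ Set.Ioo (0:ℝ) 1) (n : ℕ) : ⌊T * 2 ^ n⌋₊ < 2 ^ n := by
  have hT0 := hT.1
  rw [Nat.floor_lt (by positivity)]
  push_cast
  have : (0:ℝ) < 2 ^ n := by positivity
  nlinarith [hT.2]

theorem val_firstBits {T : ℝ} (hT : T ∈ Set.Ioo (0:ℝ) 1) (n : ℕ) :
    val (firstBits T n) = ⌊T * 2 ^ n⌋₊ := by
  rw [firstBits_eq hT, val_bits _ _ (floor_lt hT n)]

theorem length_firstBits (T : ℝ) (n : ℕ) : (firstBits T n).length = n := by simp [firstBits]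

theorem primrec_val : Primrec val := by
  unfold val
  refine Primrec.list_foldl (h := fun _ (q : ℕ × Bool) => 2 * q.1 + q.2.toNat)
    Primrec.id (Primrec.const 0) ?_
  have h : Primrec fun b : Bool => b.toNat := Primrec.dom_finite _
  exact Primrec.nat_add.comp
    (Primrec.nat_mul.comp (Primrec.const 2) (Primrec.fst.comp Primrec.snd))
    (h.comp (Primrec.snd.comp Primrec.snd))

theorem primrec_bits : Primrec bits := by
  unfold bits
  refine Primrec.list_map (Primrec.list_range.comp Primrec.snd) ?_
  have : Primrec fun x : (ℕ × ℕ) × ℕ => x.1.1 / 2 ^ (x.1.2 - 1 - x.2) % 2 :=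
    Primrec.nat_mod.comp (Primrec.nat_div.comp (Primrec.fst.comp Primrec.fst)
      (primrec_pow.comp (Primrec.const 2) (Primrec.nat_sub.comp
        (Primrec.nat_sub.comp (Primrec.snd.comp Primrec.fst) (Primrec.const 1)) Primrec.snd)))
      (Primrec.const 2)
  exact (Primrec.eq.decide).comp this (Primrec.const 1)

theorem primrec_replicate (b : Bool) : Primrec fun n => List.replicate n b := by
  have : (fun n => List.replicate n b) = fun n => (List.range n).map fun _ => b := by
    funext n; simp
  rw [this]
  exact Primrec.list_map Primrec.list_range (Primrec.const b).to₂

/-- Self-delimiting unary code. -/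
def un1 (a : ℕ) : List Bool := List.replicate a true ++ [false]

theorem un1_pfx : ∀ (a b : ℕ) (r r' : List Bool), un1 a ++ r <+: un1 b ++ r' → a = b ∧ r <+: r' := by
  intro a
  induction a with
  | zero =>
    intro b r r' h
    cases b with
    | zero => simpa [un1] using h
    | succ b => simp [un1, List.replicate_succ] at h
  | succ a ih =>
    intro b r r' h
    cases b with
    | zero => simp [un1, List.replicate_succ] at h
    | succ b =>
      have : un1 a ++ r <+: un1 b ++ r' := by
        simpa [un1, List.replicate_succ] using h
      obtain ⟨h1, h2⟩ := ih _ _ _ this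
      exact ⟨by rw [h1], h2⟩

/-- Self-delimiting code of length about `2 √x`. -/
def un (x : ℕ) : List Bool := un1 x.unpair.1 ++ un1 x.unpair.2

theorem un_pfx (a b : ℕ) (r r' : List Bool) (h : un a ++ r <+: un b ++ r') : a = b ∧ r <+: r' := by
  unfold un at h
  rw [List.append_assoc, List.append_assoc] at h
  obtain ⟨h1, h2⟩ := un1_pfx _ _ _ _ h
  obtain ⟨h3, h4⟩ := un1_pfx _ _ _ _ h2
  refine ⟨?_, h4⟩
  rw [← Nat.pair_unpair a, ← Nat.pair_unpair b, h1, h3]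

theorem unpair_le_sqrt (x : ℕ) : x.unpair.1 ≤ x.sqrt ∧ x.unpair.2 ≤ x.sqrt := by
  have := Nat.sqrt_le_add x
  unfold Nat.unpair
  have h2 := Nat.sqrt_le x
  simp only
  split_ifs with h
  · exact ⟨h.le, le_rfl⟩
  · simp only
    refine ⟨le_rfl, by omega⟩

theorem length_un (x : ℕ) : (un x).length ≤ 2 * x.sqrt + 2 := by
  have := unpair_le_sqrt x
  simp [un, un1]; omega

/-- Self-delimiting code of a triple. -/
def enc (b : ℕ × ℕ × List Bool) : List Bool := un b.1 ++ (un b.2.1 ++ (un b.2.2.length ++ b.2.2))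

theorem enc_pfx (b b' : ℕ × ℕ × List Bool) (h : enc b <+: enc b') : b = b' := by
  obtain ⟨n, j, y⟩ := b
  obtain ⟨n', j', y'⟩ := b'
  unfold enc at h
  obtain ⟨h1, h⟩ := un_pfx _ _ _ _ h
  obtain ⟨h2, h⟩ := un_pfx _ _ _ _ h
  obtain ⟨h3, h⟩ := un_pfx _ _ _ _ h
  simp only at h1 h2 h3 h
  rw [h1, h2, h.eq_of_length h3]

theorem length_enc (n j : ℕ) (y : List Bool) :
    (enc (n, j, y)).length ≤ y.length + 2 * n.sqrt + 2 * j.sqrt + 2 * y.length.sqrt + 6 := by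
  have h1 := length_un n
  have h2 := length_un j
  have h3 := length_un y.length
  simp only [enc, List.length_append]
  omega

theorem primrec_un1 : Primrec un1 :=
  Primrec.list_append.comp (primrec_replicate true) (Primrec.const [false])

theorem primrec_un : Primrec un :=
  Primrec.list_append.comp (primrec_un1.comp (Primrec.fst.comp Primrec.unpair))
    (primrec_un1.comp (Primrec.snd.comp Primrec.unpair))

theorem primrec_enc : Primrec enc :=
  Primrec.list_append.comp (primrec_un.comp Primrec.fst)
    (Primrec.list_append.comp (primrec_un.comp (Primrec.fst.comp Primrec.snd))
      (Primrec.list_append.comp (primrec_un.comp (Primrec.list_length.comp (Primrec.snd.comp Primrec.snd)))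
        (Primrec.snd.comp Primrec.snd)))

/-- The search predicate used to decode a self-delimiting program. -/
def decPred (p : List Bool) (z : ℕ) : Bool :=
  decide ((Encodable.decode (α := ℕ × ℕ × List Bool) z).map enc = some p)

theorem computable_decPred : Computable₂ decPred := by
  have : Primrec₂ decPred := by
    refine (Primrec.eq.decide).comp (Primrec.option_map (Primrec.decode.comp Primrec.snd) ?_)
      (Primrec.option_some.comp Primrec.fst)
    exact primrec_enc.comp Primrec.snd
  exact this.to_comp

theorem mkComputer (F : ℕ × ℕ × List Bool →. List Bool) (hF : Partrec F)
    (hne : ∃ b, (F b).Dom) : ∃ C : Computer, ∀ b, C.f (enc b) = F b := by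
  have key : ∀ p z, z ∈ search (decPred p) → ∃ b, Encodable.decode z = some b ∧ enc b = p := by
    intro p z hz
    have := (mem_search.1 hz).1
    simpa [decPred, Option.map_eq_some_iff, -Encodable.decode_prod_val] using this
  let f : List Bool →. List Bool := fun p =>
    (search (decPred p)).bind fun z =>
      (Part.ofOption (Encodable.decode (α := ℕ × ℕ × List Bool) z)).bind F
  have hf : ∀ b, f (enc b) = F b := by
    intro b
    have h0 : decPred (enc b) (Encodable.encode b) = true := by
      simp [decPred]
    obtain ⟨z, hz⟩ := search_dom h0
    obtain ⟨b', h1, h2⟩ := key _ _ hz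
    have hb : b' = b := enc_pfx _ _ (h2 ▸ List.prefix_rfl)
    simp only [f]
    rw [Part.eq_some_iff.2 hz, Part.bind_some, h1, Part.coe_some, hb]
    exact Part.bind_some b F
  have hdom : ∀ p ∈ f.Dom, ∃ b, enc b = p := by
    intro p hp
    rw [PFun.mem_dom] at hp
    obtain ⟨y, hy⟩ := hp
    obtain ⟨z, hz, -⟩ := Part.mem_bind_iff.1 hy
    obtain ⟨b, -, hb⟩ := key _ _ hz
    exact ⟨b, hb⟩
  refine ⟨⟨f, ?_, ?_, ?_⟩, hf⟩
  · refine Partrec.bind (partrec_search computable_decPred) ?_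
    exact Partrec.bind (Computable.ofOption (Computable.decode.comp Computable.snd))
      (hF.comp Computable.snd)
  · obtain ⟨b, hb⟩ := hne
    refine ⟨enc b, ?_⟩
    change (f (enc b)).Dom
    rw [hf]; exact hb
  · intro p hp q hq hpq
    obtain ⟨b, rfl⟩ := hdom p hp
    obtain ⟨b', rfl⟩ := hdom q hq
    rw [enc_pfx _ _ hpq]

theorem Optimal.surj {U : Computer} (hU : Optimal U) (y : List Bool) : ∃ p, y ∈ U.f p := by
  obtain ⟨C, hC⟩ := mkComputer (fun b => Part.some b.2.2)
    (Computable.snd.comp Computable.snd).partrec ⟨(0, 0, []), trivial⟩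
  obtain ⟨d, hd⟩ := hU C
  have h : C.f (enc (0, 0, y)) = Part.some y := hC (0, 0, y)
  obtain ⟨q, hq, -⟩ := hd (enc (0, 0, y)) (by change (C.f _).Dom; rw [h]; trivial)
  exact ⟨q, by rw [hq, h]; exact Part.mem_some _⟩

theorem complexity_attained {U : Computer} (hU : Optimal U) (y : List Bool) :
    ∃ p, y ∈ U.f p ∧ p.length = complexity U y := by
  obtain ⟨p, hp⟩ := hU.surj y
  exact Nat.sInf_mem (s := {n | ∃ p : List Bool, y ∈ U.f p ∧ p.length = n}) ⟨_, p, hp, rfl⟩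

theorem complexity_le {U : Computer} {y p : List Bool} (h : y ∈ U.f p) : complexity U y ≤ p.length :=
  Nat.sInf_le ⟨p, h, rfl⟩

theorem finite_length_le (N : ℕ) : {p : List Bool | p.length ≤ N}.Finite :=
  List.finite_length_le Bool N

theorem Optimal.dom_infinite {U : Computer} (hU : Optimal U) : U.f.Dom.Infinite := by
  intro hfin
  choose p hp using hU.surj
  have hinj : Function.Injective p := by
    intro y y' h
    have := hp y'
    rw [← h] at this
    exact Part.mem_unique (hp y) this
  have : (Set.range p).Finite := hfin.subset (by
    rintro _ ⟨y, rfl⟩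
    exact (PFun.mem_dom _ _).2 ⟨y, hp y⟩)
  exact Set.infinite_range_of_injective hinj this

/-- All the data extracted from a computable energy. -/
structure Setup (V : Computer) (T : ℝ) where
  E : ℝ
  hT : T ∈ Set.Ioo (0:ℝ) 1
  hE0 : 0 ≤ E
  g : ℕ → ℕ
  hgc : Computable g
  hg : ∀ s, |E * 2 ^ s - g s| ≤ 2
  c : ℕ
  hc : E + 2 ≤ c
  D : ℕ → List (List Bool)
  O : ℕ → ℕ
  hD : Primrec D
  hO : Primrec O
  hDn : ∀ k, (D k).Nodup
  hDm : ∀ j k, j ≤ k → D j ⊆ D k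
  hDd : ∀ p, p ∈ V.f.Dom ↔ ∃ k, p ∈ D k
  hDO : ∀ k, ∀ p ∈ D k, ∀ y ∈ V.f p, y.length < O k
  p₀ : V.f.Dom
  hne : ((p₀.1.length : ℕ) : ℝ) ≠ E
  k0 : ℕ
  hk0 : ∀ p : V.f.Dom, (p.1.length : ℝ) ≤ E → p.1 ∈ D k0
  hp0 : p₀.1 ∈ D k0
  hsum : HasSum (fun p : V.f.Dom => phi (p.1.length - E) T) 0

theorem hasSum_phi (V : Computer) {T : ℝ} (hT : T ∈ Set.Ioo (0:ℝ) 1) :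
    HasSum (fun p : V.f.Dom => phi (p.1.length - Efun V T) T) 0 := by
  have hs := V.summable_half.1
  have h0 := summable_boltz hs 0 hT
  have h1 := summable_boltz hs 1 hT
  simp only [pow_zero, one_mul, pow_one] at h0 h1
  have hZ : 0 < Zfun V T := by
    obtain ⟨p, hp⟩ := V.dom_nonempty
    unfold Zfun boltzmann
    exact h0.tsum_pos (fun p => by positivity) ⟨p, hp⟩ (by positivity)
  have e0 : HasSum (fun p : V.f.Dom => (2:ℝ) ^ (-(p.1.length : ℝ) / T)) (Zfun V T) := h0.hasSum
  have e1 : HasSum (fun p : V.f.Dom => (p.1.length : ℝ) * (2:ℝ) ^ (-(p.1.length : ℝ) / T))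
      (Zfun V T * Efun V T) := by
    have : Zfun V T * Efun V T = ∑' p : V.f.Dom, (p.1.length : ℝ) * boltzmann T p.1 := by
      unfold Efun; field_simp
    rw [this]; exact h1.hasSum
  have e2 := (e1.sub (e0.mul_left (Efun V T))).mul_left ((2:ℝ) ^ (Efun V T / T))
  have e3 : (2:ℝ) ^ (Efun V T / T) * (Zfun V T * Efun V T - Efun V T * Zfun V T) = 0 := by ring
  rw [e3] at e2
  refine e2.congr_fun ?_
  intro p
  rw [phi_eq]; ring

theorem exists_setup {V : Computer} (hV : Optimal V) {T : ℝ} (hT : T ∈ Set.Ioo (0:ℝ) 1)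
    (hE : ComputableReal (Efun V T)) : Nonempty (Setup V T) := by
  have hE0 : 0 ≤ Efun V T := by
    unfold Efun Zfun boltzmann
    exact mul_nonneg (inv_nonneg.2 (tsum_nonneg fun p => by positivity))
      (tsum_nonneg fun p => by positivity)
  obtain ⟨g, hgc, hg⟩ := exists_nat_approx _ hE0 hE
  obtain ⟨c, hc⟩ := exists_nat_ge (Efun V T + 2)
  obtain ⟨D, O, hD, hO, hDn, hDm, hDd, hDO⟩ := V.exists_stages
  have hinf := hV.dom_infinite
  obtain ⟨p₀, hp₀, hne⟩ : ∃ p ∈ V.f.Dom, ((p.length : ℕ) : ℝ) ≠ Efun V T := by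
    by_contra! h
    apply hinf
    refine (finite_length_le ⌊Efun V T⌋₊).subset fun p hp => ?_
    exact Nat.le_floor (h p hp).le
  have hfin : {p : List Bool | p ∈ V.f.Dom ∧ ((p.length : ℝ) ≤ Efun V T ∨ p = p₀)}.Finite := by
    refine (((finite_length_le ⌊Efun V T⌋₊).union (Set.finite_singleton p₀))).subset ?_
    rintro p ⟨-, h | h⟩
    · exact Or.inl (Nat.le_floor h)
    · exact Or.inr h
  obtain ⟨k0, hk0⟩ : ∃ k0, ∀ p, p ∈ V.f.Dom ∧ ((p.length : ℝ) ≤ Efun V T ∨ p = p₀) → p ∈ D k0 := by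
    have : ∀ p : List Bool, ∃ k, p ∈ V.f.Dom → p ∈ D k := by
      intro p
      by_cases h : p ∈ V.f.Dom
      · obtain ⟨k, hk⟩ := (hDd p).1 h
        exact ⟨k, fun _ => hk⟩
      · exact ⟨0, fun h' => absurd h' h⟩
    choose κ hκ using this
    refine ⟨hfin.toFinset.sup κ, fun p hp => ?_⟩
    exact hDm _ _ (Finset.le_sup (f := κ) (hfin.mem_toFinset.2 hp)) (hκ p hp.1)
  exact ⟨⟨Efun V T, hT, hE0, g, hgc, hg, c, hc, D, O, hD, hO, hDn, hDm, hDd, hDO, ⟨p₀, hp₀⟩, hne,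
    k0, fun p hp => hk0 _ ⟨p.2, Or.inl hp⟩, hk0 _ ⟨hp₀, Or.inr rfl⟩, hasSum_phi V hT⟩⟩

namespace Setup
variable {V : Computer} {T : ℝ} (X : Setup V T)

/-- The finite set of programs found at stage `k`. -/
noncomputable def S (k : ℕ) : Finset V.f.Dom := by
  classical exact (X.D k).toFinset.subtype (· ∈ V.f.Dom)

theorem mem_S {k : ℕ} {p : V.f.Dom} : p ∈ X.S k ↔ p.1 ∈ X.D k := by
  simp [S]

/-- The lengths of the programs found at stage `k`. -/
def lens (k : ℕ) : List ℕ := (X.D k).map List.length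

theorem sum_S (k : ℕ) (f : ℕ → ℝ) : ∑ p ∈ X.S k, f p.1.length = ((X.lens k).map f).sum := by
  classical
  have h1 : ∑ p ∈ X.S k, f p.1.length = ∑ p ∈ (X.D k).toFinset, f p.length := by
    unfold S
    exact Finset.sum_subtype_of_mem (fun p : List Bool => f p.length) fun p hp =>
      (X.hDd p).2 ⟨k, List.mem_toFinset.1 hp⟩
  rw [h1, List.sum_toFinset _ (X.hDn k), lens, List.map_map]
  rfl

/-- The truncated defect function. -/
noncomputable def Phi (k : ℕ) (t : ℝ) : ℝ := ∑ p ∈ X.S k, phi (p.1.length - X.E) t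

theorem Phi_eq (k : ℕ) (t : ℝ) : X.Phi k t = (2:ℝ) ^ (X.E / t) * Gl X.E t (X.lens k) := by
  unfold Phi Gl
  rw [X.sum_S k (fun L => phi (L - X.E) t), ← List.sum_map_mul_left]
  congr 1
  apply List.map_congr_left
  intro L _
  exact phi_eq _ _ _

theorem Phi_pos {k : ℕ} {t : ℝ} : 0 < X.Phi k t ↔ 0 < Gl X.E t (X.lens k) := by
  rw [Phi_eq]; exact mul_pos_iff_of_pos_left (by positivity)

theorem Phi_neg {k : ℕ} {t : ℝ} : X.Phi k t < 0 ↔ Gl X.E t (X.lens k) < 0 := by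
  rw [Phi_eq]
  have : 0 < (2:ℝ) ^ (X.E / t) := by positivity
  constructor
  · intro h; by_contra h2; push Not at h2
    exact absurd h (not_lt.2 (by positivity))
  · intro h; exact mul_neg_of_pos_of_neg this h

theorem tendsto_S : Tendsto X.S atTop atTop := by
  refine tendsto_atTop_finset_of_monotone ?_ ?_
  · intro j k hjk p hp
    exact X.mem_S.2 (X.hDm _ _ hjk (X.mem_S.1 hp))
  · intro p
    obtain ⟨k, hk⟩ := (X.hDd p.1).1 p.2
    exact ⟨k, X.mem_S.2 hk⟩

theorem tendsto_Phi : Tendsto (fun k => X.Phi k T) atTop (𝓝 0) := X.hsum.comp X.tendsto_S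

theorem low_mem {k : ℕ} (hk : X.k0 ≤ k) (p : V.f.Dom) (hp : (p.1.length : ℝ) ≤ X.E) : p ∈ X.S k :=
  X.mem_S.2 (X.hDm _ _ hk (X.hk0 p hp))

theorem p0_mem {k : ℕ} (hk : X.k0 ≤ k) : X.p₀ ∈ X.S k := X.mem_S.2 (X.hDm _ _ hk X.hp0)

theorem strictMono {k : ℕ} (hk : X.k0 ≤ k) {s t : ℝ} (hs : 0 < s) (hst : s < t) :
    X.Phi k s < X.Phi k t :=
  sum_phi_strictMono (L := fun p : V.f.Dom => p.1.length) (X.S k) hs hst X.p₀ (X.p0_mem hk) X.hne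

theorem Phi_nonpos {k : ℕ} (hk : X.k0 ≤ k) : X.Phi k T ≤ 0 :=
  (tail_term (L := fun p : V.f.Dom => p.1.length) X.hT.1 X.hsum (X.S k) (X.low_mem hk)).1

theorem exists_lower : ∃ c : ℝ, 0 < c ∧ ∀ t, T ≤ t → t ≤ 1 → ∀ k, X.k0 ≤ k →
    c * (t - T) ≤ X.Phi k t - X.Phi k T := by
  obtain ⟨c, hc, h⟩ := lower_lip (L := fun p : V.f.Dom => p.1.length) X.hT X.p₀ X.hne
  exact ⟨c, hc, fun t h1 h2 k hk => h t h1 h2 (X.S k) (X.p0_mem hk)⟩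

theorem computable_lens : Computable X.lens :=
  (Primrec.list_map X.hD (Primrec.list_length.comp Primrec.snd).to₂).to_comp


/-- Search predicate of the randomness machine. -/
def pred1 (x : List Bool) (z : ℕ) : Bool :=
  decide (X.k0 ≤ z.unpair.1) &&
    certP X.c ((val x + 1, x.length, z.unpair.2), X.g z.unpair.2, X.lens z.unpair.1)

theorem computable_pred1 : Computable₂ X.pred1 := by
  have hz1 : Computable fun q : List Bool × ℕ => q.2.unpair.1 :=
    (Primrec.fst.comp (Primrec.unpair.comp Primrec.snd)).to_comp
  have hz2 : Computable fun q : List Bool × ℕ => q.2.unpair.2 :=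
    (Primrec.snd.comp (Primrec.unpair.comp Primrec.snd)).to_comp
  have h1 : Computable fun q : List Bool × ℕ => decide (X.k0 ≤ q.2.unpair.1) :=
    (Primrec.nat_le.decide.to_comp (f := fun a b : ℕ => decide (a ≤ b))).comp (Computable.const X.k0) hz1
  have h2 : Computable fun q : List Bool × ℕ => certP X.c
      ((val q.1 + 1, q.1.length, q.2.unpair.2), X.g q.2.unpair.2, X.lens q.2.unpair.1) := by
    refine (primrec_certP X.c).to_comp.comp ?_
    refine Computable.pair (Computable.pair ?_ (Computable.pair ?_ hz2))
      (Computable.pair (X.hgc.comp hz2) (X.computable_lens.comp hz1))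
    · exact (Primrec.succ.comp (primrec_val.comp Primrec.fst)).to_comp
    · exact (Primrec.list_length.comp Primrec.fst).to_comp
  exact (Primrec.and.to_comp).comp h1 h2

theorem pred1_found (n : ℕ) : ∃ z, z ∈ search (X.pred1 (firstBits T n)) := by
  obtain ⟨c, hc, hlow⟩ := X.exists_lower
  set a := ⌊T * 2 ^ n⌋₊ + 1 with ha
  have hn : (0:ℝ) < 2 ^ n := by positivity
  have h1 : T < (a:ℝ) / 2 ^ n := by
    rw [lt_div_iff₀ hn, ha]; push_cast; exact Nat.lt_floor_add_one _
  have h2 : (a:ℝ) / 2 ^ n ≤ 1 := by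
    rw [div_le_one hn]
    have := floor_lt X.hT n
    have h' : a ≤ 2 ^ n := this
    exact_mod_cast h'
  have hpos : 0 < c * ((a:ℝ) / 2 ^ n - T) := mul_pos hc (by linarith)
  have hev : ∀ᶠ k in atTop, - (c * ((a:ℝ) / 2 ^ n - T)) < X.Phi k T :=
    X.tendsto_Phi.eventually (lt_mem_nhds (by linarith))
  obtain ⟨k, hk1, hk2⟩ := (hev.and (eventually_ge_atTop X.k0)).exists
  have h3 := hlow _ h1.le h2 k hk2
  have h4 : 0 < X.Phi k ((a:ℝ) / 2 ^ n) := by linarith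
  obtain ⟨s, hs⟩ := (certP_complete X.hE0 X.hc (Nat.succ_pos _) X.hg (X.Phi_pos.1 h4)).exists
  refine search_dom (n := Nat.pair k s) ?_
  simp only [pred1, Nat.unpair_pair, val_firstBits X.hT, length_firstBits, Bool.and_eq_true,
    decide_eq_true_eq]
  exact ⟨hk2, hs⟩

theorem exists_machine1 (U : Computer) (hU : Optimal U) : ∃ C : Computer, ∀ n p, firstBits T n ∈ U.f p →
    ∃ k a, X.k0 ≤ k ∧ a = ⌊T * 2 ^ n⌋₊ + 1 ∧ 0 < X.Phi k ((a:ℝ) / 2 ^ n) ∧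
      C.f p = Part.some (List.replicate (X.O k) false) := by
  let f : List Bool →. List Bool := fun p => (U.f p).bind fun x =>
    (search (X.pred1 x)).map fun z => List.replicate (X.O z.unpair.1) false
  have hf : ∀ n p, firstBits T n ∈ U.f p → ∃ k a, X.k0 ≤ k ∧ a = ⌊T * 2 ^ n⌋₊ + 1 ∧
      0 < X.Phi k ((a:ℝ) / 2 ^ n) ∧ f p = Part.some (List.replicate (X.O k) false) := by
    intro n p hp
    obtain ⟨z, hz⟩ := X.pred1_found n
    have h := (mem_search.1 hz).1
    simp only [pred1, val_firstBits X.hT, length_firstBits, Bool.and_eq_true,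
      decide_eq_true_eq] at h
    refine ⟨z.unpair.1, _, h.1, rfl, X.Phi_pos.2 (certP_sound X.hE0 X.hc (Nat.succ_pos _) (X.hg _) h.2), ?_⟩
    simp only [f]
    rw [Part.eq_some_iff.2 hp, Part.bind_some, Part.eq_some_iff.2 hz, Part.map_some]
  refine ⟨⟨f, ?_, ?_, ?_⟩, hf⟩
  · refine Partrec.bind U.partrec ?_
    refine Partrec.map ((partrec_search X.computable_pred1).comp Computable.snd) ?_
    exact ((primrec_replicate false).comp (X.hO.comp (Primrec.fst.comp (Primrec.unpair.comp Primrec.snd)))).to_comp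
  · obtain ⟨p, hp⟩ := hU.surj (firstBits T 0)
    obtain ⟨k, a, -, -, -, h⟩ := hf 0 p hp
    exact ⟨p, (PFun.mem_dom _ _).2 ⟨_, Part.eq_some_iff.1 h⟩⟩
  · have hsub : ∀ p ∈ f.Dom, p ∈ U.f.Dom := by
      intro p hp
      obtain ⟨y, hy⟩ := (PFun.mem_dom _ _).1 hp
      obtain ⟨x, hx, -⟩ := Part.mem_bind_iff.1 hy
      exact (PFun.mem_dom _ _).2 ⟨x, hx⟩
    intro p hp q hq
    exact U.dom_prefixFree p (hsub p hp) q (hsub q hq)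

theorem random (X : Setup V T) (hV : Optimal V) (U : Computer) (hU : Optimal U) : ChaitinTRandom U T T := by
  have hT0 := X.hT.1
  obtain ⟨M1, hM1⟩ := X.exists_machine1 U hU
  obtain ⟨d, hd⟩ := hV M1
  obtain ⟨B, C, hTB, hB1, hC0, hup⟩ := upper_lip V.summable_half.1 X.hE0 X.hT
  have key : ∀ n : ℕ, T + (1 / 2) ^ n ≤ B → ∃ L : ℕ, X.E < L ∧ L ≤ complexity U (firstBits T n) + d ∧
      phi (L - X.E) T ≤ C * (1 / 2) ^ n := by
    intro n hn
    obtain ⟨p, hp, hpl⟩ := complexity_attained hU (firstBits T n)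
    obtain ⟨k, a, hk, ha, hpos, hCp⟩ := hM1 n p hp
    obtain ⟨q, hq, hql⟩ := hd p ((PFun.mem_dom _ _).2 ⟨_, Part.eq_some_iff.1 hCp⟩)
    have hqm := Part.eq_some_iff.1 (hq.trans hCp)
    have hqD : q ∈ V.f.Dom := (PFun.mem_dom _ _).2 ⟨_, hqm⟩
    have hqS : (⟨q, hqD⟩ : V.f.Dom) ∉ X.S k := by
      intro h
      have := X.hDO k q (X.mem_S.1 h) _ hqm
      simp at this
    have htt := (tail_term (L := fun p : V.f.Dom => p.1.length) X.hT.1 X.hsum (X.S k) (X.low_mem hk)).2 _ hqS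
    have hn' : (0:ℝ) < 2 ^ n := by positivity
    have h1 : T < (a:ℝ) / 2 ^ n := by
      rw [lt_div_iff₀ hn', ha]; push_cast; exact Nat.lt_floor_add_one _
    have h2 : (a:ℝ) / 2 ^ n ≤ T + (1 / 2) ^ n := by
      rw [div_le_iff₀ hn', add_mul, ← mul_pow, ha]
      have := Nat.floor_le (a := T * 2 ^ n) (by positivity)
      push_cast; norm_num; linarith
    have h3 := hup _ h1.le (h2.trans hn) (X.S k)
    refine ⟨q.length, ?_, by omega, ?_⟩
    · by_contra h
      exact hqS (X.low_mem hk ⟨q, hqD⟩ (not_lt.1 h))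
    · have h4 : C * ((a:ℝ) / 2 ^ n - T) ≤ C * (1 / 2) ^ n := by gcongr; linarith
      have h5 : 0 < ∑ p ∈ X.S k, phi (p.1.length - X.E) ((a:ℝ) / 2 ^ n) := hpos
      linarith
  unfold ChaitinTRandom
  rw [tendsto_atTop]
  intro M
  set M' := M + d with hM'
  set Y := C * (2:ℝ) ^ (M' / T) with hY
  set δ := ((⌊X.E⌋₊ : ℝ) + 1 - X.E) * (2:ℝ) ^ (-Y / T) with hδ
  have hδ0 : 0 < δ := by
    have := Nat.lt_floor_add_one X.E
    have : 0 < (⌊X.E⌋₊ : ℝ) + 1 - X.E := by linarith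
    positivity
  have hz : Tendsto (fun n : ℕ => (1 / 2 : ℝ) ^ n) atTop (𝓝 0) :=
    tendsto_pow_atTop_nhds_zero_of_lt_one (by norm_num) (by norm_num)
  have ev1 : ∀ᶠ n : ℕ in atTop, (1 / 2 : ℝ) ^ n < B - T := hz.eventually (gt_mem_nhds (by linarith))
  have ev2 : ∀ᶠ n : ℕ in atTop, C * (1 / 2 : ℝ) ^ n < δ := by
    have := hz.const_mul C
    rw [mul_zero] at this
    exact this.eventually (gt_mem_nhds hδ0)
  filter_upwards [ev1, ev2] with n h1 h2
  obtain ⟨L, hL1, hL2, hL3⟩ := key n (by linarith)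
  by_contra hcon
  push Not at hcon
  have hL2' : (L:ℝ) ≤ complexity U (firstBits T n) + d := by exact_mod_cast hL2
  set x := (L:ℝ) - X.E with hx
  have hx0 : 0 < x := by linarith
  have hxle : x ≤ T * n + M' := by have := X.hE0; linarith
  have hp : (1 / 2 : ℝ) ^ n * (2:ℝ) ^ (-(M' / T)) ≤ (2:ℝ) ^ (-x / T) := by
    have : (1 / 2 : ℝ) ^ n = (2:ℝ) ^ (-(n:ℝ)) := by
      rw [Real.rpow_neg (by norm_num), Real.rpow_natCast]; simp
    rw [this, ← Real.rpow_add (by norm_num)]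
    apply Real.rpow_le_rpow_of_exponent_le (by norm_num)
    have : x / T ≤ n + M' / T := by
      rw [div_le_iff₀ hT0, add_mul, div_mul_cancel₀ _ hT0.ne']; linarith
    rw [neg_div]; linarith
  have hxY : x ≤ Y := by
    have h3 : x * ((1 / 2 : ℝ) ^ n * (2:ℝ) ^ (-(M' / T))) ≤ C * (1 / 2) ^ n :=
      (mul_le_mul_of_nonneg_left hp hx0.le).trans hL3
    rw [Real.rpow_neg (by norm_num)] at h3
    have hq : 0 < (2:ℝ) ^ (M' / T) := by positivity
    have hn : (0:ℝ) < (1 / 2) ^ n := by positivity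
    have h4 : x * ((2:ℝ) ^ (M' / T))⁻¹ ≤ C := by
      have : (x * ((2:ℝ) ^ (M' / T))⁻¹) * (1 / 2 : ℝ) ^ n ≤ C * (1 / 2) ^ n := by linarith
      exact le_of_mul_le_mul_right this hn
    rwa [← div_eq_mul_inv, div_le_iff₀ hq] at h4
  have hfl : (⌊X.E⌋₊ : ℝ) + 1 ≤ L := by
    have : ⌊X.E⌋₊ + 1 ≤ L := (Nat.floor_lt X.hE0).2 hL1
    exact_mod_cast this
  have : δ ≤ phi x T := by
    unfold phi
    rw [hδ]
    gcongr
    · linarith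
    · norm_num
  linarith

end Setup

/-- Test whether the truncated halting probability exceeds the value of `y`. -/
def omTest (q : List Bool × List ℕ) : Bool :=
  decide (val q.1 * 2 ^ q.2.sum < (q.2.map fun L => 2 ^ (q.1.length + q.2.sum - L)).sum)

theorem omTest_iff (y : List Bool) (l : List ℕ) :
    omTest (y, l) = true ↔ (val y : ℝ) < 2 ^ y.length * (l.map fun L => (1 / 2 : ℝ) ^ L).sum := by
  have h : (((l.map fun L => 2 ^ (y.length + l.sum - L)).sum : ℕ) : ℝ) =
      2 ^ l.sum * (2 ^ y.length * (l.map fun L => (1 / 2 : ℝ) ^ L).sum) := by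
    rw [Nat.cast_list_sum, List.map_map, ← mul_assoc, ← List.sum_map_mul_left]
    congr 1
    apply List.map_congr_left
    intro L hL
    have : L ≤ l.sum := List.le_sum_of_mem hL
    simp only [Function.comp]
    obtain ⟨r, hr⟩ := Nat.exists_eq_add_of_le this
    have e : y.length + l.sum - L = y.length + r := by omega
    rw [e, hr]
    push_cast
    rw [pow_add, pow_add, one_div, inv_pow]
    field_simp
  unfold omTest
  simp only [decide_eq_true_eq]
  rw [← Nat.cast_lt (α := ℝ), h]
  push_cast
  rw [mul_comm]
  exact mul_lt_mul_iff_right₀ (by positivity)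

theorem primrec_omTest : Primrec omTest := by
  have hsum : Primrec fun l : List ℕ => l.sum := by
    have := primrec_sum_map (f := fun l : List ℕ => l) (g := fun _ (x : ℕ) => x) Primrec.id Primrec.snd.to₂
    simpa using this
  refine Primrec.nat_lt.decide.comp ?_ ?_
  · exact Primrec.nat_mul.comp (primrec_val.comp Primrec.fst)
      (primrec_pow.comp (Primrec.const 2) (hsum.comp Primrec.snd))
  · refine primrec_sum_map (f := fun q : List Bool × List ℕ => q.2)
      (g := fun q L => 2 ^ (q.1.length + q.2.sum - L)) Primrec.snd ?_
    refine primrec_pow.comp (Primrec.const 2) ?_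
    refine Primrec.nat_sub.comp (Primrec.nat_add.comp ?_ ?_) Primrec.snd
    · exact Primrec.list_length.comp (Primrec.fst.comp Primrec.fst)
    · exact hsum.comp (Primrec.snd.comp Primrec.fst)

namespace Setup
variable {V : Computer} {T : ℝ} (X : Setup V T)

/-- Search predicate of the compression machine. -/
def pred2 (b : ℕ × List Bool) (z : ℕ) : Bool :=
  (decide (X.k0 ≤ z.unpair.1) && decide (3 ≤ z.unpair.2.unpair.1)) &&
  (omTest (b.2, X.lens z.unpair.1) &&
  (certP X.c ((z.unpair.2.unpair.1, b.1, z.unpair.2.unpair.2), X.g z.unpair.2.unpair.2, X.lens z.unpair.1) &&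
   certN X.c ((z.unpair.2.unpair.1 - 2, b.1, z.unpair.2.unpair.2), X.g z.unpair.2.unpair.2,
    X.lens z.unpair.1)))

theorem computable_pred2 : Computable₂ X.pred2 := by
  have pz : Primrec fun q : (ℕ × List Bool) × ℕ => q.2.unpair := Primrec.unpair.comp Primrec.snd
  have pw : Primrec fun q : (ℕ × List Bool) × ℕ => q.2.unpair.2.unpair :=
    Primrec.unpair.comp (Primrec.snd.comp pz)
  have hk : Computable fun q : (ℕ × List Bool) × ℕ => q.2.unpair.1 := (Primrec.fst.comp pz).to_comp
  have ha : Computable fun q : (ℕ × List Bool) × ℕ => q.2.unpair.2.unpair.1 := (Primrec.fst.comp pw).to_comp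
  have hs : Computable fun q : (ℕ × List Bool) × ℕ => q.2.unpair.2.unpair.2 := (Primrec.snd.comp pw).to_comp
  have hn : Computable fun q : (ℕ × List Bool) × ℕ => q.1.1 := Computable.fst.comp Computable.fst
  have hy : Computable fun q : (ℕ × List Bool) × ℕ => q.1.2 := Computable.snd.comp Computable.fst
  have hl := X.computable_lens.comp hk
  have hle := (Primrec.nat_le.decide.to_comp (f := fun a b : ℕ => decide (a ≤ b)))
  have hsub : Computable₂ fun a b : ℕ => a - b := Primrec.nat_sub.to_comp
  have hand := Primrec.and.to_comp
  refine hand.comp (hand.comp (hle.comp (Computable.const X.k0) hk) (hle.comp (Computable.const 3) ha)) ?_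
  refine hand.comp (primrec_omTest.to_comp.comp (Computable.pair hy hl)) ?_
  refine hand.comp ?_ ?_
  · exact (primrec_certP X.c).to_comp.comp (Computable.pair (Computable.pair ha (Computable.pair hn hs))
      (Computable.pair (X.hgc.comp hs) hl))
  · exact (primrec_certN X.c).to_comp.comp (Computable.pair (Computable.pair
      (hsub.comp ha (Computable.const 2)) (Computable.pair hn hs))
      (Computable.pair (X.hgc.comp hs) hl))

/-- The advice string. -/
theorem exists_advice (X : Setup V T) (m : ℕ) : ∃ y : List Bool, y.length = m ∧
    (val y : ℝ) < 2 ^ m * ∑' p : V.f.Dom, (1 / 2 : ℝ) ^ p.1.length ∧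
    2 ^ m * ∑' p : V.f.Dom, (1 / 2 : ℝ) ^ p.1.length ≤ val y + 1 := by
  obtain ⟨hs, h1⟩ := V.summable_half
  have h0 : 0 < ∑' p : V.f.Dom, (1 / 2 : ℝ) ^ p.1.length :=
    hs.tsum_pos (fun p => by positivity) X.p₀ (by positivity)
  set Ω := ∑' p : V.f.Dom, (1 / 2 : ℝ) ^ p.1.length with hΩ
  have hpos : 0 < 2 ^ m * Ω := by positivity
  obtain ⟨v, hv⟩ : ∃ v, ⌈2 ^ m * Ω⌉₊ = v + 1 :=
    Nat.exists_eq_succ_of_ne_zero (Nat.ceil_pos.2 hpos).ne'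
  have hv1 : (v:ℝ) < 2 ^ m * Ω := Nat.lt_ceil.1 (by omega)
  have hv2 : 2 ^ m * Ω ≤ v + 1 := by
    have := Nat.le_ceil (2 ^ m * Ω)
    rw [hv] at this
    exact_mod_cast this
  have hv3 : v < 2 ^ m := by
    have : (v:ℝ) < 2 ^ m := hv1.trans_le (mul_le_of_le_one_right (by positivity) h1)
    exact_mod_cast this
  refine ⟨bits (v, m), length_bits _ _, ?_⟩
  rw [val_bits _ _ hv3]
  exact ⟨hv1, hv2⟩

theorem exists_tail : ∃ K : ℝ, 0 ≤ K ∧ ∀ k n m : ℕ, X.k0 ≤ k → T * n ≤ m →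
    ∑' p : V.f.Dom, (1 / 2 : ℝ) ^ p.1.length - ((X.lens k).map fun L => (1 / 2 : ℝ) ^ L).sum ≤ (1 / 2) ^ m →
    - X.Phi k T ≤ K * (m + 1) * (1 / 2) ^ n := by
  obtain ⟨K, hK0, hK⟩ := tail_bound V.summable_half.1 X.hE0 X.hT
  refine ⟨K, hK0, fun k n m hk hnm h => ?_⟩
  rw [← X.sum_S k fun L => (1 / 2 : ℝ) ^ L] at h
  refine (hK (X.S k) m (X.low_mem hk) h X.hsum).trans ?_
  have : (1 / 2 : ℝ) ^ n = (2:ℝ) ^ (-(n:ℝ)) := by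
    rw [Real.rpow_neg (by norm_num), Real.rpow_natCast]; simp
  rw [this]
  gcongr
  · norm_num
  · rw [neg_div, neg_le_neg_iff, le_div_iff₀ X.hT.1]; linarith

theorem exists_compress : ∃ A : ℝ, 0 ≤ A ∧ ∀ᶠ n : ℕ in atTop, ∃ y : List Bool, y.length = ⌈T * n⌉₊ ∧
    ∃ z j : ℕ, z ∈ search (X.pred2 (n, y)) ∧ bits (z.unpair.2.unpair.1 - j, n) = firstBits T n ∧
      (j:ℝ) ≤ A * (⌈T * n⌉₊ + 1) + 3 := by
  have hT0 := X.hT.1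
  obtain ⟨K, hK0, hK⟩ := X.exists_tail
  obtain ⟨c, hc, hlow⟩ := X.exists_lower
  refine ⟨K / c, by positivity, ?_⟩
  have ev1 : ∀ᶠ n : ℕ in atTop, 2 ≤ T * 2 ^ n :=
    ((tendsto_pow_atTop_atTop_of_one_lt (one_lt_two (α := ℝ))).const_mul_atTop hT0).eventually_ge_atTop 2
  have ev2 : ∀ᶠ n : ℕ in atTop, K / c * (n + 2) * (1 / 2) ^ n < 1 - T := by
    have h1 := tendsto_self_mul_const_pow_of_lt_one (r := (1/2:ℝ)) (by norm_num) (by norm_num)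
    have h2 : Tendsto (fun n : ℕ => (1 / 2 : ℝ) ^ n) atTop (𝓝 0) :=
      tendsto_pow_atTop_nhds_zero_of_lt_one (by norm_num) (by norm_num)
    have h3 := (h1.add (h2.const_mul 2)).const_mul (K / c)
    simp only [mul_zero, add_zero] at h3
    have h4 := h3.eventually (gt_mem_nhds (show (0:ℝ) < 1 - T by have := X.hT.2; linarith))
    filter_upwards [h4] with n hn
    calc _ = K / c * (n * (1 / 2) ^ n + 2 * (1 / 2) ^ n) := by ring
      _ < _ := hn
  filter_upwards [ev1, ev2] with n hn1 hn2
  set m := ⌈T * n⌉₊ with hm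
  have hm1 : T * n ≤ m := Nat.le_ceil _
  have hm2 : (m:ℝ) ≤ n + 1 := by
    have h := Nat.ceil_lt_add_one (a := T * n) (by positivity)
    have : T * n ≤ n := mul_le_of_le_one_left (by positivity) X.hT.2.le
    linarith
  obtain ⟨y, hy, hy1, hy2⟩ := X.exists_advice m
  refine ⟨y, hy, ?_⟩
  have h2n : (0:ℝ) < 2 ^ n := by positivity
  have h2m : (0:ℝ) < 2 ^ m := by positivity
  set δ := K / c * (m + 1) * (1 / 2) ^ n with hδ
  have hδ0 : 0 ≤ δ := by positivity
  have hδn : δ * 2 ^ n = K / c * (m + 1) := by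
    rw [hδ, mul_assoc, ← mul_pow]; norm_num
  have hδ1 : T + δ ≤ 1 := by
    have : δ ≤ K / c * (n + 2) * (1 / 2) ^ n := by
      rw [hδ]
      have : (m:ℝ) + 1 ≤ n + 2 := by linarith
      gcongr
    linarith
  -- what a good stage gives
  have good : ∀ k, X.k0 ≤ k → omTest (y, X.lens k) = true → 0 ≤ X.Phi k (T + δ) := by
    intro k hk ho
    rw [omTest_iff, hy] at ho
    have h1 := hK k n m hk hm1 (by
      rw [one_div_pow (2:ℝ) m, le_div_iff₀ h2m]
      linarith)
    have h2 := hlow (T + δ) (by linarith) hδ1 k hk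
    have h3 : c * (T + δ - T) = K * (m + 1) * (1 / 2) ^ n := by
      rw [hδ]; field_simp; ring
    linarith
  -- the search succeeds
  have hfound : ∃ z, z ∈ search (X.pred2 (n, y)) := by
    have hs := V.summable_half.1.hasSum.comp X.tendsto_S
    have ev : ∀ᶠ k in atTop, (val y : ℝ) / 2 ^ m < ∑ p ∈ X.S k, (1 / 2 : ℝ) ^ p.1.length :=
      hs.eventually (lt_mem_nhds (by rw [div_lt_iff₀ h2m]; linarith))
    obtain ⟨k, hk1, hk2⟩ := (ev.and (eventually_ge_atTop X.k0)).exists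
    have ho : omTest (y, X.lens k) = true := by
      rw [omTest_iff, hy, ← X.sum_S k fun L => (1 / 2 : ℝ) ^ L]
      rw [div_lt_iff₀ h2m] at hk1; linarith
    have hcont : ContinuousOn (X.Phi k) (Set.Icc T (T + δ)) :=
      (continuousOn_sum_phi (L := fun p : V.f.Dom => p.1.length) (E := X.E) (X.S k)).mono
        fun t ht => hT0.trans_le ht.1
    obtain ⟨t, ht, ht0⟩ := intermediate_value_Icc (by linarith) hcont ⟨X.Phi_nonpos hk2, good k hk2 ho⟩
    have htpos : 0 < t := hT0.trans_le ht.1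
    have hfl : 2 ≤ ⌊t * 2 ^ n⌋₊ := by
      apply Nat.le_floor
      have : T * 2 ^ n ≤ t * 2 ^ n := by gcongr; exact ht.1
      push_cast; linarith
    have hfle := Nat.floor_le (a := t * 2 ^ n) (by positivity)
    set a := ⌊t * 2 ^ n⌋₊ + 1 with ha
    have hP : 0 < X.Phi k ((a:ℝ) / 2 ^ n) := by
      rw [← ht0]
      apply X.strictMono hk2 htpos
      rw [lt_div_iff₀ h2n, ha]; push_cast; exact Nat.lt_floor_add_one _
    have ha2 : a - 2 + 1 = ⌊t * 2 ^ n⌋₊ := by omega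
    have ha2' : ((a - 2 : ℕ) : ℝ) + 1 = ⌊t * 2 ^ n⌋₊ := by exact_mod_cast ha2
    have ha3 : 0 < a - 2 := by omega
    have hN : X.Phi k (((a - 2 : ℕ):ℝ) / 2 ^ n) < 0 := by
      rw [← ht0]
      apply X.strictMono hk2
      · have : (0:ℝ) < ((a - 2 : ℕ):ℝ) := by exact_mod_cast ha3
        positivity
      · rw [div_lt_iff₀ h2n]; linarith
    obtain ⟨s, hs1, hs2⟩ := ((certP_complete X.hE0 X.hc (Nat.succ_pos _) X.hg (X.Phi_pos.1 hP)).and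
      (certN_complete X.hE0 X.hc ha3 X.hg (X.Phi_neg.1 hN))).exists
    refine search_dom (n := Nat.pair k (Nat.pair a s)) ?_
    simp only [pred2, Nat.unpair_pair, Bool.and_eq_true, decide_eq_true_eq]
    exact ⟨⟨hk2, by omega⟩, ho, hs1, hs2⟩
  obtain ⟨z, hz⟩ := hfound
  have h := (mem_search.1 hz).1
  simp only [pred2, Bool.and_eq_true, decide_eq_true_eq] at h
  obtain ⟨⟨hk, ha3⟩, ho, hP, hN⟩ := h
  set k := z.unpair.1
  set a := z.unpair.2.unpair.1
  set s := z.unpair.2.unpair.2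
  have hP' := X.Phi_pos.2 (certP_sound X.hE0 X.hc (by omega) (X.hg _) hP)
  have hN' := X.Phi_neg.2 (certN_sound X.hE0 X.hc (by omega) (X.hg _) hN)
  have haT : T < (a:ℝ) / 2 ^ n := by
    by_contra hcon
    rcases (not_lt.1 hcon).lt_or_eq with h1 | h1
    · have ha0 : (0:ℝ) < a := by exact_mod_cast (by omega : 0 < a)
      have := X.strictMono hk (by positivity) h1
      have := X.Phi_nonpos hk
      linarith
    · rw [h1] at hP'
      have := X.Phi_nonpos hk
      linarith
  have haU : ((a - 2 : ℕ):ℝ) / 2 ^ n < T + δ := by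
    by_contra hcon
    rcases (not_lt.1 hcon).lt_or_eq with h1 | h1
    · have := X.strictMono hk (by linarith) h1
      have := good k hk ho
      linarith
    · rw [← h1] at hN'
      have := good k hk ho
      linarith
  rw [lt_div_iff₀ h2n] at haT
  rw [div_lt_iff₀ h2n, add_mul, hδn, Nat.cast_sub (by omega)] at haU
  have hfa : ⌊T * 2 ^ n⌋₊ ≤ a := by
    have := Nat.floor_le_floor haT.le
    rwa [Nat.floor_natCast] at this
  refine ⟨z, a - ⌊T * 2 ^ n⌋₊, hz, ?_, ?_⟩
  · rw [firstBits_eq X.hT]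
    congr 2
    omega
  · rw [Nat.cast_sub hfa]
    have := Nat.lt_floor_add_one (T * 2 ^ n)
    push_cast at haU
    linarith

theorem compressible (X : Setup V T) (U : Computer) (hU : Optimal U) : TCompressible U T T := by
  have hT0 := X.hT.1
  obtain ⟨A, hA0, hA⟩ := X.exists_compress
  let F : ℕ × ℕ × List Bool →. List Bool := fun b =>
    (search (X.pred2 (b.1, b.2.2))).map fun z => bits (z.unpair.2.unpair.1 - b.2.1, b.1)
  have hFp : Partrec F := by
    refine Partrec.map ((partrec_search X.computable_pred2).comp ?_) ?_
    · exact Computable.pair Computable.fst (Computable.snd.comp Computable.snd)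
    · refine Primrec.to_comp (primrec_bits.comp (Primrec.pair (Primrec.nat_sub.comp ?_ ?_) ?_))
      · exact Primrec.fst.comp (Primrec.unpair.comp (Primrec.snd.comp (Primrec.unpair.comp Primrec.snd)))
      · exact Primrec.fst.comp (Primrec.snd.comp Primrec.fst)
      · exact Primrec.fst.comp Primrec.fst
  have hFv : ∀ {n j : ℕ} {y : List Bool} {z : ℕ}, z ∈ search (X.pred2 (n, y)) →
      F (n, j, y) = Part.some (bits (z.unpair.2.unpair.1 - j, n)) := by
    intro n j y z hz
    simp only [F]
    rw [Part.eq_some_iff.2 hz, Part.map_some]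
  obtain ⟨C, hC⟩ := mkComputer F hFp (by
    obtain ⟨n, y, -, z, j, hz, -⟩ := hA.exists
    exact ⟨(n, j, y), by rw [hFv hz]; trivial⟩)
  obtain ⟨d, hd⟩ := hU C
  have key : ∀ᶠ n : ℕ in atTop, (complexity U (firstBits T n) : ℝ) ≤
      T * n + ((4 + 2 * √(2 * A + 3)) * √n + (7 + d)) := by
    filter_upwards [hA, eventually_ge_atTop 1] with n hn hn1
    obtain ⟨y, hy, z, j, hz, hb, hj⟩ := hn
    have hn1' : (1:ℝ) ≤ n := by exact_mod_cast hn1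
    have e : C.f (enc (n, j, y)) = Part.some (firstBits T n) := by rw [hC, hFv hz, hb]
    obtain ⟨q, hq, hql⟩ := hd (enc (n, j, y)) ((PFun.mem_dom _ _).2 ⟨_, Part.eq_some_iff.1 e⟩)
    have h1 := complexity_le (Part.eq_some_iff.1 (hq.trans e))
    have h2 := length_enc n j y
    rw [hy] at h2
    set m := ⌈T * n⌉₊ with hm
    have hm1 : (m:ℝ) < T * n + 1 := Nat.ceil_lt_add_one (by positivity)
    have hm2 : m ≤ n := by
      rw [hm, Nat.ceil_le]
      exact mul_le_of_le_one_left (by positivity) X.hT.2.le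
    have hm2' : (m:ℝ) ≤ n := by exact_mod_cast hm2
    have h3 : complexity U (firstBits T n) ≤ m + 2 * n.sqrt + 2 * j.sqrt + 2 * m.sqrt + 6 + d := by omega
    have h3' : (complexity U (firstBits T n) : ℝ) ≤
        m + 2 * n.sqrt + 2 * j.sqrt + 2 * m.sqrt + 6 + d := by exact_mod_cast h3
    have s1 : (n.sqrt : ℝ) ≤ √n := Real.nat_sqrt_le_real_sqrt
    have s2 : (m.sqrt : ℝ) ≤ √n := Real.nat_sqrt_le_real_sqrt.trans (Real.sqrt_le_sqrt hm2')
    have s3 : (j.sqrt : ℝ) ≤ √(2 * A + 3) * √n := by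
      refine Real.nat_sqrt_le_real_sqrt.trans ?_
      rw [← Real.sqrt_mul (by positivity)]
      apply Real.sqrt_le_sqrt
      refine hj.trans ?_
      have : A * (m + 1) ≤ A * (2 * n) := by gcongr; linarith
      linarith
    linarith
  obtain ⟨N, hN⟩ := eventually_atTop.1 key
  refine ⟨fun n => if n < N then (complexity U (firstBits T n) : ℝ) else
    (4 + 2 * √(2 * A + 3)) * √n + (7 + d), ?_, ?_⟩
  · have h0 : Tendsto (fun n : ℕ => (√(n:ℝ))⁻¹) atTop (𝓝 0) :=
      tendsto_inv_atTop_zero.comp (Real.tendsto_sqrt_atTop.comp tendsto_natCast_atTop_atTop)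
    have h1 : Tendsto (fun n : ℕ => ((n:ℝ))⁻¹) atTop (𝓝 0) :=
      tendsto_inv_atTop_zero.comp tendsto_natCast_atTop_atTop
    have h2 := (h0.const_mul (4 + 2 * √(2 * A + 3))).add (h1.const_mul (7 + (d:ℝ)))
    simp only [mul_zero, add_zero] at h2
    refine h2.congr' ?_
    filter_upwards [eventually_ge_atTop N, eventually_ge_atTop 1] with n hn hn1
    have hn1' : (0:ℝ) < n := by exact_mod_cast hn1
    have hs : √(n:ℝ) ≠ 0 := (Real.sqrt_pos.2 hn1').ne'
    have hs2 : √(n:ℝ) * √n = n := Real.mul_self_sqrt hn1'.le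
    rw [if_neg (not_lt.2 hn)]
    have : (√(n:ℝ))⁻¹ = √n / n := by
      rw [eq_div_iff hn1'.ne']
      calc (√(n:ℝ))⁻¹ * n = (√(n:ℝ))⁻¹ * (√n * √n) := by rw [hs2]
        _ = √n := by rw [← mul_assoc, inv_mul_cancel₀ hs, one_mul]
    rw [this]; ring
  · intro n hn
    beta_reduce
    split_ifs with h
    · have : 0 ≤ T * n := by positivity
      linarith
    · exact hN n (not_lt.1 h)

end Setup

/-- Fixed point theorem for `E`. If `V` is optimal, `T ∈ (0,1)`
and `E_V(T)` is computable, then `T` is Chaitin `T`-random and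
`T`-compressible. -/
theorem fixedPoint_of_energy_computable
    (U : Computer) (hU : Optimal U) (V : Computer) (hV : Optimal V)
    (T : ℝ) (hT : T ∈ Set.Ioo (0 : ℝ) 1) (hE : ComputableReal (Efun V T)) :
    ChaitinTRandom U T T ∧ TCompressible U T T := by
  obtain ⟨X⟩ := exists_setup hV hT hE
  exact ⟨X.random hV U hU, X.compressible U hU⟩
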